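/- Fix α ∈ (0,1) and positive integers n ≥ 2, k ≤ n, p, λ with m = pλ. There exists a universal constant C₁ > 0 such that if m ≥ p ≥ C₁·k·log⁴(n)/α², then for every row vector v ∈ ℝ^λ with v ≠ 0, taking V = I_p ⊗ v and V̂ = (1/(‖v‖₂√p))·V, and Φ ∈ ℂ^{m×n} drawn from the sign-randomized bounded orthogonal ensemble, one has E sup_{x∈T_k} | ‖V̂Φx‖₂² − ‖x‖₂² | ≤ α. -/

import Mathlib

open scoped BigOperators Matrix
noncomputable section

/-- The sign `±1` associated with a boolean. -/
def rsign (b : Bool) : ℝ := if b then 1 else -1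

/-- Euclidean norm of a real vector. -/
def norm2 {n : ℕ} (x : Fin n → ℝ) : ℝ := Real.sqrt (∑ j, (x j) ^ 2)

/-- Euclidean norm of a complex vector. -/
def norm2C {n : ℕ} (x : Fin n → ℂ) : ℝ := Real.sqrt (∑ j, ‖x j‖ ^ 2)

/-- `T_k`: complex unit-norm vectors with at most `k` nonzero entries. -/
def Tk (n k : ℕ) : Set (Fin n → ℂ) :=
  {x | norm2C x = 1 ∧ ∃ s : Finset (Fin n), s.card ≤ k ∧ ∀ t ∉ s, x t = 0}

/-- Block-diagonal matrix `I_p ⊗ v` with `p` copies of the row vector `v` on the diagonal. -/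
def kronRow (p : ℕ) {lam : ℕ} (v : Fin lam → ℝ) : Matrix (Fin p) (Fin (p * lam)) ℝ :=
  Matrix.of fun i j =>
    if (j : ℕ) / lam = (i : ℕ) then
      (if h2 : (j : ℕ) % lam < lam then v ⟨(j : ℕ) % lam, h2⟩ else 0)
    else 0

lemma expect_exp_rademacher_le {J : Type*} [Fintype J] [DecidableEq J] (c : J → ℝ) :
    𝔼 δ : J → Bool, Real.exp (∑ j, rsign (δ j) * c j) ≤ Real.exp ((∑ j, c j ^ 2) / 2) := by
  have h1 : ∑ δ : J → Bool, Real.exp (∑ j, rsign (δ j) * c j) = ∏ j, (2 * Real.cosh (c j)) := by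
    simp_rw [Real.exp_sum]
    rw [← Fintype.piFinset_univ,
      ← Finset.prod_univ_sum (fun _ => Finset.univ) (fun j (b : Bool) => Real.exp (rsign b * c j))]
    refine Finset.prod_congr rfl fun j _ => ?_
    simp [rsign, Real.cosh_eq]
    ring
  rw [Fintype.expect_eq_sum_div_card, h1, Finset.prod_mul_distrib, Finset.sum_div, Real.exp_sum]
  simp only [Finset.prod_const, Finset.card_univ, Fintype.card_fun, Fintype.card_bool,
    Nat.cast_pow, Nat.cast_ofNat]
  rw [mul_div_cancel_left₀ _ (by positivity)]
  exact Finset.prod_le_prod (fun j _ => (Real.cosh_pos _).le) fun j _ => Real.cosh_le_exp_half_sq _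

lemma expect_iSup_rademacher_le {J ι : Type*} [Fintype J] [DecidableEq J] [Fintype ι] [Nonempty ι]
    (c : ι → J → ℝ) {σ : ℝ} (hσ : 0 ≤ σ) (hc : ∀ s, ∑ j, c s j ^ 2 ≤ σ ^ 2) :
    𝔼 δ : J → Bool, (⨆ s, |∑ j, rsign (δ j) * c s j|)
      ≤ σ * √(2 * Real.log (2 * Fintype.card ι)) := by
  have hcard : (1 : ℝ) ≤ Fintype.card ι := by exact_mod_cast Fintype.card_pos
  have hlog : 0 < Real.log (2 * Fintype.card ι) := Real.log_pos (by linarith)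
  rcases hσ.eq_or_lt with rfl | hσ
  · have h0 : ∀ s j, c s j = 0 := by
      intro s j
      have h := hc s
      have h2 : c s j ^ 2 ≤ ∑ j, c s j ^ 2 :=
        Finset.single_le_sum (f := fun j => c s j ^ 2) (fun j _ => sq_nonneg _) (Finset.mem_univ j)
      nlinarith [sq_nonneg (c s j)]
    simp [h0]
  set l := Real.log (2 * Fintype.card ι) with hl
  have key : ∀ θ : ℝ, 0 < θ → θ * 𝔼 δ : J → Bool, (⨆ s, |∑ j, rsign (δ j) * c s j|)
      ≤ l + θ ^ 2 * σ ^ 2 / 2 := by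
    intro θ hθ
    set K := l + θ ^ 2 * σ ^ 2 / 2 with hK
    have hmgf : ∀ s (η : ℝ), η ^ 2 = θ ^ 2 →
        𝔼 δ : J → Bool, Real.exp (∑ j, rsign (δ j) * (η * c s j))
          ≤ Real.exp (θ ^ 2 * σ ^ 2 / 2) := by
      intro s η hη
      refine (expect_exp_rademacher_le _).trans (Real.exp_le_exp.2 ?_)
      simp_rw [mul_pow, hη, ← Finset.mul_sum]
      have := mul_le_mul_of_nonneg_left (hc s) (sq_nonneg θ)
      linarith
    have hpt : ∀ δ : J → Bool, θ * (⨆ s, |∑ j, rsign (δ j) * c s j|) ≤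
        (K - 1) + Real.exp (-K) * ∑ s, (Real.exp (∑ j, rsign (δ j) * (θ * c s j)) +
          Real.exp (∑ j, rsign (δ j) * (-θ * c s j))) := by
      intro δ
      obtain ⟨s, hs⟩ := exists_eq_ciSup_of_finite (f := fun s => |∑ j, rsign (δ j) * c s j|)
      rw [← hs]
      have e1 : ∀ η : ℝ, ∑ j, rsign (δ j) * (η * c s j) = η * ∑ j, rsign (δ j) * c s j := by
        intro η; rw [Finset.mul_sum]; exact Finset.sum_congr rfl fun j _ => by ring
      have h2 := Finset.single_le_sum
        (f := fun s => Real.exp (∑ j, rsign (δ j) * (θ * c s j)) +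
          Real.exp (∑ j, rsign (δ j) * (-θ * c s j))) (fun s _ => by positivity) (Finset.mem_univ s)
      simp only [e1] at h2
      have h3 : Real.exp (θ * |∑ j, rsign (δ j) * c s j|) ≤
          Real.exp (θ * ∑ j, rsign (δ j) * c s j) + Real.exp (-θ * ∑ j, rsign (δ j) * c s j) := by
        rcases abs_cases (∑ j, rsign (δ j) * c s j) with h | h <;> rw [h.1]
        · linarith [Real.exp_pos (-θ * ∑ j, rsign (δ j) * c s j)]
        · rw [mul_neg, ← neg_mul]
          linarith [Real.exp_pos (θ * ∑ j, rsign (δ j) * c s j)]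
      have h4 := Real.add_one_le_exp (-K + θ * |∑ j, rsign (δ j) * c s j|)
      rw [Real.exp_add] at h4
      have h5 := mul_le_mul_of_nonneg_left (h3.trans h2) (Real.exp_pos (-K)).le
      linarith
    rw [Finset.mul_expect]
    refine (Finset.expect_le_expect fun δ _ => hpt δ).trans ?_
    rw [Finset.expect_add_distrib, ← Finset.mul_expect, Finset.expect_sum_comm,
      Fintype.expect_const]
    have h6 : ∑ s, 𝔼 δ : J → Bool, (Real.exp (∑ j, rsign (δ j) * (θ * c s j)) +
          Real.exp (∑ j, rsign (δ j) * (-θ * c s j))) ≤ Real.exp K := by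
      calc _ ≤ ∑ s : ι, 2 * Real.exp (θ ^ 2 * σ ^ 2 / 2) := by
            refine Finset.sum_le_sum fun s _ => ?_
            rw [Finset.expect_add_distrib]
            linarith [hmgf s θ rfl, hmgf s (-θ) (by ring)]
        _ = _ := by
            rw [hK, Real.exp_add, hl, Real.exp_log (by positivity)]
            simp; ring
    have h7 := mul_le_mul_of_nonneg_left h6 (Real.exp_pos (-K)).le
    rw [← Real.exp_add, neg_add_cancel, Real.exp_zero] at h7
    linarith
  have hsq : √(2 * l) ^ 2 = 2 * l := Real.sq_sqrt (by positivity)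
  have hs0 : 0 < √(2 * l) := Real.sqrt_pos.2 (by positivity)
  have h := key (√(2 * l) / σ) (by positivity)
  rw [div_pow, hsq, div_mul_cancel₀ _ (by positivity), div_mul_eq_mul_div, div_le_iff₀ hσ] at h
  nlinarith

lemma exists_small_sums {ι ρ : Type*} [Fintype ι] [Fintype ρ] [Nonempty ρ] (q : ι → ℝ)
    (hq : ∀ i, 0 ≤ q i) (hq1 : ∑ i, q i = 1) (Y : ι → ρ → ℝ) {c : ℝ} (hc : 0 < c)
    (hY : ∀ i r, |Y i r| ≤ c) (hmean : ∀ r, ∑ i, q i * Y i r = 0) (N : ℕ) (hN : 0 < N) :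
    ∃ φ : Fin N → ι, ∀ r, |∑ s, Y (φ s) r| ≤ c * √(2 * N * Real.log (2 * Fintype.card ρ)) := by
  have hcard : (1 : ℝ) ≤ Fintype.card ρ := by exact_mod_cast Fintype.card_pos
  set l := Real.log (2 * Fintype.card ρ) with hl
  have hlog : 0 < l := Real.log_pos (by linarith)
  have hexp : ∀ (r : ρ) (θ : ℝ), ∑ i, q i * Real.exp (θ * Y i r) ≤ Real.exp (θ ^ 2 * c ^ 2 / 2) := by
    intro r θ
    have hconv : ∀ i, Real.exp (θ * Y i r) ≤
        Real.cosh (θ * c) + Y i r / c * Real.sinh (θ * c) := by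
      intro i
      have h1 := abs_le.1 (hY i r)
      have hl : -1 ≤ Y i r / c := by rw [le_div_iff₀ hc]; linarith
      have hr : Y i r / c ≤ 1 := by rw [div_le_iff₀ hc]; linarith
      have h := convexOn_exp.2 (Set.mem_univ (θ * c)) (Set.mem_univ (-(θ * c)))
        (show 0 ≤ (1 + Y i r / c) / 2 by linarith) (show 0 ≤ (1 - Y i r / c) / 2 by linarith)
        (by ring)
      simp only [smul_eq_mul] at h
      have e : (1 + Y i r / c) / 2 * (θ * c) + (1 - Y i r / c) / 2 * -(θ * c) = θ * Y i r := by
        field_simp; ring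
      rw [e] at h
      rw [Real.cosh_eq, Real.sinh_eq]
      linarith
    calc _ ≤ ∑ i, q i * (Real.cosh (θ * c) + Y i r / c * Real.sinh (θ * c)) :=
          Finset.sum_le_sum fun i _ => mul_le_mul_of_nonneg_left (hconv i) (hq i)
      _ = (∑ i, q i) * Real.cosh (θ * c) + (∑ i, q i * Y i r) * (Real.sinh (θ * c) / c) := by
          rw [Finset.sum_mul, Finset.sum_mul, ← Finset.sum_add_distrib]
          exact Finset.sum_congr rfl fun i _ => by ring
      _ ≤ _ := by
          rw [hq1, hmean r, one_mul, zero_mul, add_zero, ← mul_pow]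
          exact Real.cosh_le_exp_half_sq _
  have key : ∀ (θ : ℝ) (M : ℕ), ∃ φ : Fin M → ι,
      ∑ r, (Real.exp (θ * ∑ s, Y (φ s) r) + Real.exp (-θ * ∑ s, Y (φ s) r))
        ≤ 2 * Fintype.card ρ * Real.exp (θ ^ 2 * c ^ 2 / 2) ^ M := by
    intro θ M
    induction M with
    | zero => exact ⟨Fin.elim0, by simp; linarith⟩
    | succ M ih =>
      obtain ⟨φ, hφ⟩ := ih
      by_contra! hcon
      set B := 2 * Fintype.card ρ * Real.exp (θ ^ 2 * c ^ 2 / 2) ^ (M + 1) with hB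
      have hlt : B < ∑ i, q i * ∑ r, (Real.exp (θ * (Y i r + ∑ s, Y (φ s) r)) +
          Real.exp (-θ * (Y i r + ∑ s, Y (φ s) r))) := by
        have hex : ∃ i, 0 < q i := by
          by_contra! h
          have := Finset.sum_nonpos fun i (_ : i ∈ Finset.univ) => h i
          linarith
        have : B = ∑ i, q i * B := by rw [← Finset.sum_mul, hq1, one_mul]
        rw [this]
        have hc2 : ∀ i, B < ∑ r, (Real.exp (θ * (Y i r + ∑ s, Y (φ s) r)) +
            Real.exp (-θ * (Y i r + ∑ s, Y (φ s) r))) := by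
          intro i
          have h := hcon (Fin.cons i φ)
          simpa [Fin.sum_univ_succ] using h
        obtain ⟨i, hi⟩ := hex
        exact Finset.sum_lt_sum (fun i _ => mul_le_mul_of_nonneg_left (hc2 i).le (hq i))
          ⟨i, Finset.mem_univ i, mul_lt_mul_of_pos_left (hc2 i) hi⟩
      refine absurd hlt (not_lt.2 ?_)
      calc _ = ∑ r, ((∑ i, q i * Real.exp (θ * Y i r)) * Real.exp (θ * ∑ s, Y (φ s) r) +
            (∑ i, q i * Real.exp (-θ * Y i r)) * Real.exp (-θ * ∑ s, Y (φ s) r)) := by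
            rw [Finset.sum_congr rfl fun i _ => Finset.mul_sum _ _ (q i), Finset.sum_comm]
            refine Finset.sum_congr rfl fun r _ => ?_
            rw [Finset.sum_mul, Finset.sum_mul, ← Finset.sum_add_distrib]
            refine Finset.sum_congr rfl fun i _ => ?_
            rw [mul_add θ, mul_add (-θ), Real.exp_add, Real.exp_add]
            ring
        _ ≤ ∑ r, Real.exp (θ ^ 2 * c ^ 2 / 2) * (Real.exp (θ * ∑ s, Y (φ s) r) +
              Real.exp (-θ * ∑ s, Y (φ s) r)) := by
            refine Finset.sum_le_sum fun r _ => ?_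
            have h1 := hexp r θ
            have h2 := hexp r (-θ)
            rw [neg_sq] at h2
            rw [mul_add]
            gcongr
        _ ≤ _ := by
            rw [← Finset.mul_sum, hB, pow_succ _ M]
            have := mul_le_mul_of_nonneg_left hφ (Real.exp_pos (θ ^ 2 * c ^ 2 / 2)).le
            linarith
  have hN' : (0 : ℝ) < N := by exact_mod_cast hN
  set R := √(2 * N * l) with hR
  have hRsq : R ^ 2 = 2 * N * l := Real.sq_sqrt (by positivity)
  have hRpos : 0 < R := Real.sqrt_pos.2 (by positivity)
  set θ := R / (c * N) with hθ
  have hθpos : 0 < θ := by positivity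
  obtain ⟨φ, hφ⟩ := key θ N
  refine ⟨φ, fun r => ?_⟩
  have h2 := Finset.single_le_sum
    (f := fun r => Real.exp (θ * ∑ s, Y (φ s) r) + Real.exp (-θ * ∑ s, Y (φ s) r))
    (fun r _ => by positivity) (Finset.mem_univ r)
  have h3 : Real.exp (θ * |∑ s, Y (φ s) r|) ≤
      Real.exp (θ * ∑ s, Y (φ s) r) + Real.exp (-θ * ∑ s, Y (φ s) r) := by
    rcases abs_cases (∑ s, Y (φ s) r) with h | h <;> rw [h.1]
    · linarith [Real.exp_pos (-θ * ∑ s, Y (φ s) r)]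
    · rw [mul_neg, ← neg_mul]
      linarith [Real.exp_pos (θ * ∑ s, Y (φ s) r)]
  have h4 := (h3.trans h2).trans hφ
  rw [← Real.exp_log (show (0 : ℝ) < 2 * Fintype.card ρ by positivity), ← Real.exp_nat_mul,
    ← Real.exp_add, Real.exp_le_exp, ← hl] at h4
  have h5 : N * (θ ^ 2 * c ^ 2 / 2) = l := by
    rw [hθ, div_pow, hRsq]; field_simp
  rw [h5, hθ, div_mul_eq_mul_div, div_le_iff₀ (by positivity)] at h4
  have h6 : R * |∑ s, Y (φ s) r| ≤ R * (c * R) := by nlinarith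
  exact le_of_mul_le_mul_left h6 hRpos

/-- The real basis `e_t, i e_t` of `ℂ^n`. -/
def realBasis {n : ℕ} (s : Fin n × Bool) : Fin n → ℂ :=
  Pi.single s.1 (if s.2 then 1 else Complex.I)

/-- The coordinates with respect to `realBasis`. -/
def realCoord {n : ℕ} (x : Fin n → ℂ) (s : Fin n × Bool) : ℝ :=
  if s.2 then (x s.1).re else (x s.1).im

lemma sum_realCoord_smul {n : ℕ} (x : Fin n → ℂ) :
    ∑ s, realCoord x s • realBasis s = x := by
  funext t
  rw [Fintype.sum_prod_type, Finset.sum_apply, Finset.sum_eq_single t]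
  · apply Complex.ext <;> simp [realCoord, realBasis]
  · intro b _ hb
    simp [realCoord, realBasis, hb.symm]
  · simp

lemma norm2C_sq {n : ℕ} (x : Fin n → ℂ) : norm2C x ^ 2 = ∑ j, ‖x j‖ ^ 2 :=
  Real.sq_sqrt (by positivity)

lemma sum_realCoord_sq {n : ℕ} (x : Fin n → ℂ) : ∑ s, realCoord x s ^ 2 = norm2C x ^ 2 := by
  rw [norm2C_sq, Fintype.sum_prod_type]
  refine Finset.sum_congr rfl fun t _ => ?_
  simp [realCoord, Complex.sq_norm, Complex.normSq_apply]
  ring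

lemma sum_abs_realCoord_le {n : ℕ} (x : Fin n → ℂ) (s : Finset (Fin n)) (hs : ∀ t ∉ s, x t = 0) :
    ∑ i, |realCoord x i| ≤ √(2 * s.card) * norm2C x := by
  have h0 : 0 ≤ norm2C x := Real.sqrt_nonneg _
  refine abs_le_of_sq_le_sq' ?_ (by positivity) |>.2
  rw [mul_pow, Real.sq_sqrt (by positivity), ← sum_realCoord_sq]
  have h1 : ∑ i, |realCoord x i| = ∑ i ∈ s ×ˢ (Finset.univ : Finset Bool), |realCoord x i| := by
    refine (Finset.sum_subset (Finset.subset_univ _) fun i _ hi => ?_).symm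
    have : x i.1 = 0 := hs _ fun h => hi (by simp [h])
    simp [realCoord, this]
  have h2 := sq_sum_le_card_mul_sum_sq (s := s ×ˢ (Finset.univ : Finset Bool))
    (f := fun i => |realCoord x i|)
  rw [h1]
  refine h2.trans ?_
  simp only [sq_abs, Finset.card_product, Finset.card_univ, Fintype.card_bool]
  push_cast
  rw [mul_comm (s.card : ℝ)]
  exact mul_le_mul_of_nonneg_left (Finset.sum_le_sum_of_subset_of_nonneg (Finset.subset_univ _)
    fun i _ _ => sq_nonneg _) (by positivity)

lemma norm_mulVec_realBasis_le {n : ℕ} {U : Matrix (Fin n) (Fin n) ℂ} (hU : ∀ i j, ‖U i j‖ ≤ 1)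
    (s : Fin n × Bool) : ‖U *ᵥ realBasis s‖ ≤ 1 := by
  rw [pi_norm_le_iff_of_nonneg zero_le_one]
  intro r
  rcases s with ⟨t, _ | _⟩ <;> simp [realBasis, Matrix.mulVec_single, hU]

lemma norm_mulVec_le_sum {n : ℕ} {U : Matrix (Fin n) (Fin n) ℂ} (hU : ∀ i j, ‖U i j‖ ≤ 1)
    (x : Fin n → ℂ) : ‖U *ᵥ x‖ ≤ ∑ s, |realCoord x s| := by
  conv_lhs => rw [← sum_realCoord_smul x, Matrix.mulVec_sum]
  refine (norm_sum_le _ _).trans (Finset.sum_le_sum fun s _ => ?_)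
  rw [Matrix.mulVec_smul, norm_smul, Real.norm_eq_abs]
  exact mul_le_of_le_one_right (abs_nonneg _) (norm_mulVec_realBasis_le hU s)

lemma sum_norm_mulVec_sq {n : ℕ} {U : Matrix (Fin n) (Fin n) ℂ}
    (hU : Uᴴ * U = (n : ℂ) • (1 : Matrix (Fin n) (Fin n) ℂ)) (x : Fin n → ℂ) :
    ∑ r, ‖(U *ᵥ x) r‖ ^ 2 = n * norm2C x ^ 2 := by
  have h1 : ∀ y : Fin n → ℂ, ((∑ r, ‖y r‖ ^ 2 : ℝ) : ℂ) = star y ⬝ᵥ y := by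
    intro y
    simp only [dotProduct, Pi.star_apply, RCLike.star_def, Complex.conj_mul']
    push_cast
    rfl
  have h2 : ((∑ r, ‖(U *ᵥ x) r‖ ^ 2 : ℝ) : ℂ) = ((n * norm2C x ^ 2 : ℝ) : ℂ) := by
    rw [h1, norm2C_sq, Complex.ofReal_mul, h1, Matrix.star_mulVec, Matrix.dotProduct_mulVec,
      Matrix.vecMul_vecMul, hU, ← Matrix.dotProduct_mulVec]
    simp [Matrix.smul_mulVec]
  exact_mod_cast h2

lemma norm2C_le_norm_mulVec {n : ℕ} {U : Matrix (Fin n) (Fin n) ℂ} (hn : 0 < n)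
    (hU : Uᴴ * U = (n : ℂ) • (1 : Matrix (Fin n) (Fin n) ℂ)) (x : Fin n → ℂ) :
    norm2C x ≤ ‖U *ᵥ x‖ := by
  have hn' : (0 : ℝ) < n := by exact_mod_cast hn
  refine abs_le_of_sq_le_sq' ?_ (norm_nonneg _) |>.2
  have h1 : ∑ r, ‖(U *ᵥ x) r‖ ^ 2 ≤ ∑ r : Fin n, ‖U *ᵥ x‖ ^ 2 :=
    Finset.sum_le_sum fun r _ => pow_le_pow_left₀ (norm_nonneg _) (norm_le_pi_norm _ r) 2
  rw [sum_norm_mulVec_sq hU] at h1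
  simp only [Finset.sum_const, Finset.card_univ, Fintype.card_fin, nsmul_eq_mul] at h1
  exact le_of_mul_le_mul_left h1 hn'

lemma realBasis_mem_Tk {n k : ℕ} (hk : 0 < k) (s : Fin n × Bool) : realBasis s ∈ Tk n k := by
  refine ⟨?_, {s.1}, by simpa using Nat.succ_le_of_lt hk, fun t ht => ?_⟩
  · rw [norm2C, Finset.sum_eq_single s.1]
    · rcases s with ⟨t, _ | _⟩ <;> simp [realBasis]
    · intro b _ hb
      simp [realBasis, hb]
    · simp
  · simp only [Finset.mem_singleton] at ht
    simp [realBasis, ht]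

lemma sum_abs_realCoord_le_of_mem_Tk {n k : ℕ} {x : Fin n → ℂ} (hx : x ∈ Tk n k) :
    ∑ i, |realCoord x i| ≤ √(2 * k) := by
  obtain ⟨h1, s, hs, hxs⟩ := hx
  refine (sum_abs_realCoord_le x s hxs).trans ?_
  rw [h1, mul_one]
  have : (s.card : ℝ) ≤ k := by exact_mod_cast hs
  exact Real.sqrt_le_sqrt (by linarith)

/-- Maurey's empirical method for a vector of bounded `ℓ¹` norm. -/
lemma exists_empirical_approx {n : ℕ} (hn : 0 < n) {U : Matrix (Fin n) (Fin n) ℂ}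
    (hU : ∀ i j, ‖U i j‖ ≤ 1) {κ : ℝ} (hκ : 0 < κ) {x : Fin n → ℂ}
    (hx : ∑ i, |realCoord x i| ≤ κ) (N : ℕ) (hN : 0 < N) :
    ∃ φ : Fin N → (Fin n × Bool) × Bool,
      ‖U *ᵥ (x - (N : ℝ)⁻¹ • ∑ m, (κ * rsign (φ m).2) • realBasis (φ m).1)‖
        ≤ 4 * κ * √(2 * Real.log (4 * n) / N) := by
  have hn' : (0 : ℝ) < n := by exact_mod_cast hn
  have hN' : (0 : ℝ) < N := by exact_mod_cast hN
  have : Nonempty (Fin n) := ⟨⟨0, hn⟩⟩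
  set h : Fin n × Bool → ℝ := fun s =>
    |realCoord x s| / κ + (1 - (∑ i, |realCoord x i|) / κ) / (2 * n) with hh
  have hrest : 0 ≤ (1 - (∑ i, |realCoord x i|) / κ) / (2 * n) := by
    have : (∑ i, |realCoord x i|) / κ ≤ 1 := by rw [div_le_one hκ]; exact hx
    have : 0 ≤ 1 - (∑ i, |realCoord x i|) / κ := by linarith
    positivity
  have hsum : ∑ s, h s = 1 := by
    rw [hh, Finset.sum_add_distrib, ← Finset.sum_div]
    simp
    field_simp
    ring
  set q : (Fin n × Bool) × Bool → ℝ := fun i =>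
    (h i.1 + rsign i.2 * (realCoord x i.1 / κ)) / 2 with hqd
  have hq0 : ∀ i, 0 ≤ q i := by
    rintro ⟨s, b⟩
    have h1 : |realCoord x s / κ| ≤ h s := by
      rw [abs_div, abs_of_pos hκ, hh]
      simpa using hrest
    have h2 := abs_le.1 h1
    cases b <;> simp only [hqd, rsign] <;> simp <;> linarith
  have hq1 : ∑ i, q i = 1 := by
    rw [Fintype.sum_prod_type, ← hsum]
    refine Finset.sum_congr rfl fun s _ => ?_
    simp [hqd, rsign]
    ring
  set pt : (Fin n × Bool) × Bool → (Fin n → ℂ) := fun i => (κ * rsign i.2) • realBasis i.1 with hpt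
  have hmean : ∑ i, q i • pt i = x := by
    rw [Fintype.sum_prod_type]
    conv_rhs => rw [← sum_realCoord_smul x]
    refine Finset.sum_congr rfl fun s _ => ?_
    simp only [hqd, hpt, Fintype.sum_bool, smul_smul, ← add_smul]
    congr 1
    simp [rsign]
    field_simp
    ring
  set Y : (Fin n × Bool) × Bool → Fin n × Bool → ℝ := fun i r =>
    realCoord (U *ᵥ (pt i - x)) r with hY
  have hYlin : ∀ (y : Fin n → ℂ) r, |realCoord y r| ≤ ‖y‖ := by
    intro y r
    refine le_trans ?_ (norm_le_pi_norm y r.1)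
    unfold realCoord
    split_ifs
    · exact Complex.abs_re_le_norm _
    · exact Complex.abs_im_le_norm _
  have hptn : ∀ i, ‖U *ᵥ pt i‖ ≤ κ := by
    intro i
    rw [hpt, Matrix.mulVec_smul, norm_smul, Real.norm_eq_abs, abs_mul, abs_of_pos hκ]
    have h1 : |rsign i.2| = 1 := by unfold rsign; split_ifs <;> simp
    rw [h1, mul_one]
    exact mul_le_of_le_one_right hκ.le (norm_mulVec_realBasis_le hU _)
  have hYb : ∀ i r, |Y i r| ≤ 2 * κ := by
    intro i r
    refine (hYlin _ r).trans ?_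
    rw [Matrix.mulVec_sub]
    refine (norm_sub_le _ _).trans ?_
    linarith [hptn i, (norm_mulVec_le_sum hU x).trans hx]
  let L : Fin n × Bool → (Fin n → ℂ) →ₗ[ℝ] ℝ := fun r =>
    { toFun := fun y => realCoord (U *ᵥ y) r
      map_add' := fun y z => by
        simp only [realCoord, Matrix.mulVec_add, Pi.add_apply]
        split_ifs <;> simp
      map_smul' := fun c y => by
        simp only [realCoord, Matrix.mulVec_smul, Pi.smul_apply]
        split_ifs <;> simp }
  have hYmean : ∀ r, ∑ i, q i * Y i r = 0 := by
    intro r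
    have h1 : ∑ i, q i • L r (pt i - x) = 0 := by
      simp_rw [← map_smul, ← map_sum, smul_sub, Finset.sum_sub_distrib, ← Finset.sum_smul, hq1,
        hmean]
      simp
    exact h1
  obtain ⟨φ, hφ⟩ := exists_small_sums q hq0 hq1 Y (by positivity) hYb hYmean N hN
  refine ⟨φ, ?_⟩
  have hcard : (2 * (Fintype.card (Fin n × Bool)) : ℝ) = 4 * n := by
    simp; ring
  rw [hcard] at hφ
  have hdiff : x - (N : ℝ)⁻¹ • ∑ m, pt (φ m) = -((N : ℝ)⁻¹ • ∑ m, (pt (φ m) - x)) := by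
    rw [Finset.sum_sub_distrib, smul_sub]
    simp only [Finset.sum_const, Finset.card_univ, Fintype.card_fin]
    rw [← Nat.cast_smul_eq_nsmul ℝ, smul_smul, inv_mul_cancel₀ hN'.ne', one_smul]
    abel
  have hlog : 0 ≤ Real.log (4 * n) := Real.log_nonneg (by
    have : (1 : ℝ) ≤ n := by exact_mod_cast hn
    linarith)
  have hsqrt : √(2 * N * Real.log (4 * n)) = N * √(2 * Real.log (4 * n) / N) := by
    rw [show 2 * N * Real.log (4 * n) = (N : ℝ) ^ 2 * (2 * Real.log (4 * n) / N) by field_simp,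
      Real.sqrt_mul (by positivity), Real.sqrt_sq hN'.le]
  have hc : ∀ r, |L r (∑ m, (pt (φ m) - x))| ≤ 2 * κ * (N * √(2 * Real.log (4 * n) / N)) := by
    intro r
    rw [map_sum, ← hsqrt]
    exact hφ r
  change ‖U *ᵥ (x - (N : ℝ)⁻¹ • ∑ m, pt (φ m))‖ ≤ _
  rw [hdiff, Matrix.mulVec_neg, norm_neg, Matrix.mulVec_smul, norm_smul, Real.norm_eq_abs,
    abs_of_pos (by positivity), inv_mul_le_iff₀ hN', pi_norm_le_iff_of_nonneg (by positivity)]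
  intro t
  have h1 : |((U *ᵥ ∑ m, (pt (φ m) - x)) t).re| ≤ _ := hc (t, true)
  have h2 : |((U *ᵥ ∑ m, (pt (φ m) - x)) t).im| ≤ _ := hc (t, false)
  have h3 := Complex.norm_le_abs_re_add_abs_im ((U *ᵥ ∑ m, (pt (φ m) - x)) t)
  linarith

lemma exists_nets {n k : ℕ} (hn : 0 < n) (hk : 0 < k) {U : Matrix (Fin n) (Fin n) ℂ}
    (hU : ∀ i j, ‖U i j‖ ≤ 1) :
    ∃ π : (l : ℕ) → (Fin (4 ^ l) → (Fin n × Bool) × Bool) → (Fin n → ℂ),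
      (∀ l φ, π l φ ∈ Tk n k) ∧ ∀ l, ∀ x ∈ Tk n k, ∃ φ,
        ‖U *ᵥ (x - π l φ)‖ ≤ 16 * √(k * Real.log (4 * n)) / 2 ^ l := by
  classical
  have hk' : (0 : ℝ) < k := by exact_mod_cast hk
  have hlog : 0 ≤ Real.log (4 * n) := Real.log_nonneg (by
    have : (1 : ℝ) ≤ n := by exact_mod_cast hn
    linarith)
  set κ := √(2 * (k : ℝ)) with hκ
  set y : (l : ℕ) → (Fin (4 ^ l) → (Fin n × Bool) × Bool) → (Fin n → ℂ) := fun l φ =>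
    ((4 ^ l : ℕ) : ℝ)⁻¹ • ∑ m, (κ * rsign (φ m).2) • realBasis (φ m).1 with hy
  set ρ : ℕ → ℝ := fun l => 8 * √(k * Real.log (4 * n)) / 2 ^ l with hρ
  have happ : ∀ l, ∀ x ∈ Tk n k, ∃ φ, ‖U *ᵥ (x - y l φ)‖ ≤ ρ l := by
    intro l x hx
    obtain ⟨φ, hφ⟩ := exists_empirical_approx hn hU (κ := κ) (by positivity)
      (sum_abs_realCoord_le_of_mem_Tk hx) (4 ^ l) (by positivity)
    refine ⟨φ, hφ.trans (le_of_eq ?_)⟩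
    rw [hκ, hρ, mul_assoc, ← Real.sqrt_mul (by positivity)]
    rw [show 2 * (k : ℝ) * (2 * Real.log (4 * n) / (4 ^ l : ℕ)) =
      (2 / 2 ^ l) ^ 2 * (k * Real.log (4 * n)) by
        push_cast; rw [show (4 : ℝ) = 2 ^ 2 by norm_num, ← pow_mul, mul_comm 2 l, pow_mul]
        field_simp, Real.sqrt_mul (by positivity), Real.sqrt_sq (by positivity)]
    ring
  set x₀ : Fin n → ℂ := realBasis (⟨0, hn⟩, true)
  refine ⟨fun l φ => if h : ∃ x ∈ Tk n k, ‖U *ᵥ (x - y l φ)‖ ≤ ρ l then h.choose else x₀,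
    fun l φ => ?_, fun l x hx => ?_⟩
  · dsimp only
    split_ifs with h
    · exact h.choose_spec.1
    · exact realBasis_mem_Tk hk _
  · obtain ⟨φ, hφ⟩ := happ l x hx
    have h : ∃ x ∈ Tk n k, ‖U *ᵥ (x - y l φ)‖ ≤ ρ l := ⟨x, hx, hφ⟩
    refine ⟨φ, ?_⟩
    dsimp only
    rw [dif_pos h, ← sub_sub_sub_cancel_right x _ (y l φ), Matrix.mulVec_sub]
    refine (norm_sub_le _ _).trans ?_
    have h2 := h.choose_spec.2
    have : ρ l + ρ l = 16 * √(k * Real.log (4 * n)) / 2 ^ l := by rw [hρ]; ring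
    linarith

section Block
variable {I J : Type*} [Fintype I] [DecidableEq I] [Fintype J]

/-- The `i`-th entry of the vector obtained by summing the signed, weighted entries of `y` over the
block `β⁻¹(i)`. -/
def blockSum (β : J → I) (w : J → ℝ) (δ : J → Bool) (y : J → ℂ) (i : I) : ℂ :=
  ∑ j with β j = i, ((w j * rsign (δ j) : ℝ) : ℂ) * y j

/-- The normalized squared norm of the vector of block sums. -/
def blockEnergy (β : J → I) (w : J → ℝ) (δ : J → Bool) (y : J → ℂ) : ℝ :=
  (∑ i, ‖blockSum β w δ y i‖ ^ 2) / Fintype.card I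

/-- The normalized real inner product of two vectors of block sums. -/
def blockForm (β : J → I) (w : J → ℝ) (δ δ' : J → Bool) : (J → ℂ) →ₗ[ℝ] (J → ℂ) →ₗ[ℝ] ℝ :=
  LinearMap.mk₂ ℝ
    (fun y y' => (∑ i, (blockSum β w δ y i * star (blockSum β w δ' y' i)).re) / Fintype.card I)
    (fun y₁ y₂ y' => by
      simp only [blockSum, Pi.add_apply, mul_add, Finset.sum_add_distrib, add_mul, Complex.add_re,
        add_div])
    (fun c y y' => by
      have h : ∀ i, blockSum β w δ (c • y) i = c * blockSum β w δ y i := by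
        intro i
        simp only [blockSum, Finset.mul_sum, Pi.smul_apply, Complex.real_smul]
        exact Finset.sum_congr rfl fun j _ => by ring
      simp only [h, mul_assoc, Complex.re_ofReal_mul, ← Finset.mul_sum, smul_eq_mul, mul_div_assoc])
    (fun y y₁ y₂ => by
      simp only [blockSum, Pi.add_apply, mul_add, Finset.sum_add_distrib, star_add, Complex.add_re,
        add_div])
    (fun c y y' => by
      have h : ∀ i, star (blockSum β w δ' (c • y') i) = c * star (blockSum β w δ' y' i) := by
        intro i
        have : blockSum β w δ' (c • y') i = c * blockSum β w δ' y' i := by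
          simp only [blockSum, Finset.mul_sum, Pi.smul_apply, Complex.real_smul]
          exact Finset.sum_congr rfl fun j _ => by ring
        rw [this]
        simp
      simp only [h, mul_left_comm _ (c : ℂ), Complex.re_ofReal_mul, ← Finset.mul_sum, smul_eq_mul,
        mul_div_assoc])

lemma blockForm_apply (β : J → I) (w : J → ℝ) (δ δ' : J → Bool) (y y' : J → ℂ) :
    blockForm β w δ δ' y y' =
      (∑ i, (blockSum β w δ y i * star (blockSum β w δ' y' i)).re) / Fintype.card I := rfl

lemma blockForm_swap (β : J → I) (w : J → ℝ) (δ δ' : J → Bool) (y y' : J → ℂ) :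
    blockForm β w δ δ' y y' = blockForm β w δ' δ y' y := by
  rw [blockForm_apply, blockForm_apply]
  congr 1
  refine Finset.sum_congr rfl fun i _ => ?_
  simp
  ring

lemma blockForm_eq_sum (β : J → I) (w : J → ℝ) (δ δ' : J → Bool) (y y' : J → ℂ) :
    blockForm β w δ δ' y y' = ∑ j, rsign (δ j) *
      (w j * (y j * star (blockSum β w δ' y' (β j))).re / Fintype.card I) := by
  rw [blockForm_apply, ← Finset.sum_fiberwise Finset.univ β, Finset.sum_div]
  refine Finset.sum_congr rfl fun i _ => ?_
  rw [blockSum, Finset.sum_mul, Complex.re_sum, Finset.sum_div]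
  refine Finset.sum_congr rfl fun j hj => ?_
  rw [(Finset.mem_filter.1 hj).2, mul_assoc, Complex.re_ofReal_mul]
  ring

lemma expect_iSup_blockForm_le [DecidableEq J] [Nonempty I] {ι : Type*} [Fintype ι] [Nonempty ι]
    {β : J → I} {w : J → ℝ} (hw : ∀ i, ∑ j with β j = i, w j ^ 2 = 1)
    (y y' : ι → J → ℂ) {τ : ℝ} (hτ : 0 ≤ τ) (hy : ∀ s j, ‖y s j‖ ≤ τ)
    {Q : (J → Bool) → ℝ} (hQ0 : ∀ δ, 0 ≤ Q δ) (hQ : ∀ δ s, blockEnergy β w δ (y' s) ≤ Q δ ^ 2) :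
    𝔼 δ, 𝔼 δ', (⨆ s, |blockForm β w δ δ' (y s) (y' s)|) ≤
      τ / √(Fintype.card I) * √(2 * Real.log (2 * Fintype.card ι)) * 𝔼 δ', Q δ' := by
  have hp : (0 : ℝ) < Fintype.card I := by exact_mod_cast Fintype.card_pos
  rw [Finset.expect_comm, Finset.mul_expect]
  refine Finset.expect_le_expect fun δ' _ => ?_
  simp_rw [blockForm_eq_sum]
  refine (expect_iSup_rademacher_le _ (σ := τ / √(Fintype.card I) * Q δ')
    (by have := hQ0 δ'; positivity) fun s => ?_).trans (le_of_eq (by ring))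
  rw [← Finset.sum_fiberwise Finset.univ β]
  calc _ ≤ ∑ i, τ ^ 2 / Fintype.card I ^ 2 * ‖blockSum β w δ' (y' s) i‖ ^ 2 := by
        refine Finset.sum_le_sum fun i _ => ?_
        rw [← mul_one (_ * _), ← hw i, Finset.mul_sum]
        refine Finset.sum_le_sum fun j hj => ?_
        rw [(Finset.mem_filter.1 hj).2]
        have h1 : (y s j * star (blockSum β w δ' (y' s) i)).re ^ 2 ≤
            (τ * ‖blockSum β w δ' (y' s) i‖) ^ 2 := by
          rw [← sq_abs]
          refine pow_le_pow_left₀ (abs_nonneg _) ?_ 2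
          refine (Complex.abs_re_le_norm _).trans ?_
          rw [norm_mul, norm_star]
          exact mul_le_mul_of_nonneg_right (hy s j) (norm_nonneg _)
        rw [div_pow, mul_pow, div_mul_eq_mul_div, div_mul_eq_mul_div]
        refine div_le_div_of_nonneg_right ?_ (by positivity)
        have := mul_le_mul_of_nonneg_left h1 (sq_nonneg (w j))
        linarith
    _ = τ ^ 2 / Fintype.card I * blockEnergy β w δ' (y' s) := by
        rw [← Finset.mul_sum, blockEnergy]
        field_simp
    _ ≤ τ ^ 2 / Fintype.card I * Q δ' ^ 2 := by
        exact mul_le_mul_of_nonneg_left (hQ δ' s) (by positivity)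
    _ = _ := by
        rw [mul_pow, div_pow, Real.sq_sqrt hp.le]

lemma expect_iSup_blockForm_le' [DecidableEq J] [Nonempty I] {ι : Type*} [Fintype ι] [Nonempty ι]
    {β : J → I} {w : J → ℝ} (hw : ∀ i, ∑ j with β j = i, w j ^ 2 = 1)
    (y y' : ι → J → ℂ) {τ : ℝ} (hτ : 0 ≤ τ) (hy : ∀ s j, ‖y' s j‖ ≤ τ)
    {Q : (J → Bool) → ℝ} (hQ0 : ∀ δ, 0 ≤ Q δ) (hQ : ∀ δ s, blockEnergy β w δ (y s) ≤ Q δ ^ 2) :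
    𝔼 δ, 𝔼 δ', (⨆ s, |blockForm β w δ δ' (y s) (y' s)|) ≤
      τ / √(Fintype.card I) * √(2 * Real.log (2 * Fintype.card ι)) * 𝔼 δ, Q δ := by
  have h := expect_iSup_blockForm_le hw y' y hτ hy hQ0 hQ
  rw [Finset.expect_comm] at h
  simp_rw [blockForm_swap β w _ _ (y' _)] at h
  exact h

lemma abs_bilin_le {n : ℕ} (f : (Fin n → ℂ) →ₗ[ℝ] (Fin n → ℂ) →ₗ[ℝ] ℝ) (x y : Fin n → ℂ) {R : ℝ}
    (hR : ∀ s t, |f (realBasis s) (realBasis t)| ≤ R) :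
    |f x y| ≤ (∑ s, |realCoord x s|) * (∑ s, |realCoord y s|) * R := by
  conv_lhs => rw [← sum_realCoord_smul x, ← sum_realCoord_smul y]
  simp only [map_sum, map_smul, LinearMap.sum_apply, LinearMap.smul_apply, smul_eq_mul]
  rw [Finset.sum_mul_sum, Finset.sum_mul]
  simp_rw [Finset.mul_sum]
  rw [Finset.sum_comm]
  refine (Finset.abs_sum_le_sum_abs _ _).trans (Finset.sum_le_sum fun s _ => ?_)
  rw [Finset.sum_mul]
  refine (Finset.abs_sum_le_sum_abs _ _).trans (Finset.sum_le_sum fun t _ => ?_)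
  rw [abs_mul, abs_mul]
  have := mul_le_mul_of_nonneg_left (hR s t)
    (mul_nonneg (abs_nonneg (realCoord x s)) (abs_nonneg (realCoord y t)))
  linarith

lemma abs_bilin_diag_le_chain {n : ℕ} (f : (Fin n → ℂ) →ₗ[ℝ] (Fin n → ℂ) →ₗ[ℝ] ℝ)
    (x : Fin n → ℂ) (z : ℕ → Fin n → ℂ) (L : ℕ) :
    |f x x| ≤ |f (z 0) (z 0)| + ∑ l ∈ Finset.range L, (|f (z (l + 1) - z l) (z (l + 1))| +
      |f (z l) (z (l + 1) - z l)|) + (|f (x - z L) x| + |f (z L) (x - z L)|) := by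
  have hstep : ∀ u v, |f v v| ≤ |f u u| + (|f (v - u) v| + |f u (v - u)|) := by
    intro u v
    have e : f v v = f u u + (f (v - u) v + f u (v - u)) := by
      simp only [map_sub, LinearMap.sub_apply]; ring
    rw [e]
    exact (abs_add_le _ _).trans (by gcongr; exact abs_add_le _ _)
  refine (hstep (z L) x).trans ?_
  gcongr
  induction L with
  | zero => simp
  | succ L ih =>
    rw [Finset.sum_range_succ, ← add_assoc]
    exact (hstep (z L) _).trans (by gcongr)
end Block

section Chain
variable {I J : Type*} [Fintype I] [DecidableEq I] [Fintype J] [DecidableEq J]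

lemma sqrt_log_net_pair_le {n : ℕ} (hn : 2 ≤ n) (l : ℕ) :
    √(2 * Real.log (2 * Fintype.card ((Fin (4 ^ l) → (Fin n × Bool) × Bool) ×
      (Fin (4 ^ (l + 1)) → (Fin n × Bool) × Bool)))) ≤ 4 * 2 ^ l * √(Real.log (4 * n)) := by
  have hn' : (2 : ℝ) ≤ n := by exact_mod_cast hn
  have hlog : 0 ≤ Real.log (4 * n) := Real.log_nonneg (by linarith)
  have h1 : (2 * Fintype.card ((Fin (4 ^ l) → (Fin n × Bool) × Bool) ×
      (Fin (4 ^ (l + 1)) → (Fin n × Bool) × Bool)) : ℝ) ≤ (4 * n) ^ (8 * 4 ^ l) := by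
    have hc : ((Fintype.card ((Fin n × Bool) × Bool) : ℕ) : ℝ) = 4 * n := by simp; ring
    rw [Fintype.card_prod, Fintype.card_fun, Fintype.card_fun, Fintype.card_fin, Fintype.card_fin]
    push_cast
    rw [hc, ← pow_add]
    calc _ ≤ (4 * n : ℝ) ^ 1 * (4 * n) ^ (4 ^ l + 4 ^ (l + 1)) := by
          gcongr; linarith
      _ ≤ _ := by
          rw [← pow_add]
          refine pow_le_pow_right₀ (by linarith) ?_
          have : 1 ≤ 4 ^ l := Nat.one_le_pow _ _ (by norm_num)
          rw [pow_succ]; omega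
  have : Nonempty (Fin n) := ⟨⟨0, by omega⟩⟩
  have hpos : (0 : ℝ) < 2 * Fintype.card ((Fin (4 ^ l) → (Fin n × Bool) × Bool) ×
      (Fin (4 ^ (l + 1)) → (Fin n × Bool) × Bool)) := by
    have := Fintype.card_pos (α := (Fin (4 ^ l) → (Fin n × Bool) × Bool) ×
      (Fin (4 ^ (l + 1)) → (Fin n × Bool) × Bool))
    positivity
  have h2 := Real.log_le_log hpos h1
  rw [Real.log_pow] at h2
  rw [show 4 * (2 : ℝ) ^ l * √(Real.log (4 * n)) = √((4 * 2 ^ l) ^ 2 * Real.log (4 * n)) by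
    rw [Real.sqrt_mul (by positivity), Real.sqrt_sq (by positivity)]]
  refine Real.sqrt_le_sqrt ?_
  push_cast at h2
  rw [mul_pow, ← pow_mul, mul_comm l 2, pow_mul]
  rw [show (2 : ℝ) ^ 2 = 4 by norm_num]
  linarith

lemma log_four_mul_le {n : ℕ} (hn : 2 ≤ n) : Real.log (4 * n) ≤ 3 * Real.log n := by
  have hn' : (2 : ℝ) ≤ n := by exact_mod_cast hn
  have h := Real.log_le_log (by positivity) (show 4 * (n : ℝ) ≤ n ^ 3 by
    nlinarith [mul_nonneg (show (0 : ℝ) ≤ n by positivity)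
      (show (0 : ℝ) ≤ (n : ℝ) ^ 2 - 4 by nlinarith)])
  rw [Real.log_pow] at h
  exact_mod_cast h

lemma clog_two_le {n : ℕ} (hn : 2 ≤ n) : (Nat.clog 2 n : ℝ) ≤ 3 * Real.log n := by
  have hn' : (2 : ℝ) ≤ n := by exact_mod_cast hn
  have hlog2 : 0.69 < Real.log 2 := by linarith [Real.log_two_gt_d9]
  have h1 : 2 ^ (Nat.clog 2 n - 1) < n := Nat.pow_pred_clog_lt_self (by norm_num) (by omega)
  have hpos : 0 < Nat.clog 2 n := Nat.clog_pos (by norm_num) hn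
  have h2 : (2 : ℝ) ^ Nat.clog 2 n ≤ n ^ 2 := by
    have h3 : (2 : ℝ) ^ (Nat.clog 2 n - 1) ≤ n := by exact_mod_cast h1.le
    have h4 : (2 : ℝ) ^ Nat.clog 2 n = 2 * 2 ^ (Nat.clog 2 n - 1) := by
      rw [← pow_succ']; congr 1; omega
    nlinarith
  have h5 := Real.log_le_log (by positivity) h2
  rw [Real.log_pow, Real.log_pow] at h5
  push_cast at h5
  nlinarith [Nat.cast_nonneg (α := ℝ) (Nat.clog 2 n)]

set_option maxHeartbeats 1000000 in
/-- Chaining bound for a decoupled block Rademacher chaos indexed by sparse vectors. -/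
lemma exists_chaos_bound [Nonempty I] {n k : ℕ} (hn : 2 ≤ n) (hk : 0 < k) (hkn : k ≤ n)
    {U : Matrix (Fin n) (Fin n) ℂ} (hU : Uᴴ * U = (n : ℂ) • (1 : Matrix (Fin n) (Fin n) ℂ))
    (hU1 : ∀ i j, ‖U i j‖ ≤ 1) {β : J → I} {w : J → ℝ}
    (hw : ∀ i, ∑ j with β j = i, w j ^ 2 = 1) (a b : (Fin n → ℂ) →ₗ[ℝ] (J → ℂ))
    (ha : ∀ x j, ‖a x j‖ ≤ 2 * ‖U *ᵥ x‖) (hb : ∀ x j, ‖b x j‖ ≤ 2 * ‖U *ᵥ x‖)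
    {Qa Qb : (J → Bool) → ℝ} (hQa0 : ∀ δ, 0 ≤ Qa δ) (hQb0 : ∀ δ, 0 ≤ Qb δ)
    (hQa : ∀ δ, ∀ x ∈ Tk n k, blockEnergy β w δ (a x) ≤ Qa δ ^ 2)
    (hQb : ∀ δ, ∀ x ∈ Tk n k, blockEnergy β w δ (b x) ≤ Qb δ ^ 2) :
    ∃ W : (J → Bool) → (J → Bool) → ℝ,
      (∀ δ δ', ∀ x ∈ Tk n k, |blockForm β w δ δ' (a x) (b x)| ≤ W δ δ') ∧
      𝔼 δ, 𝔼 δ', W δ δ' ≤ 5000 * (√k * Real.log n ^ 2 / √(Fintype.card I)) *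
        ((𝔼 δ, Qa δ) + 𝔼 δ, Qb δ) := by
  classical
  have hn' : (2 : ℝ) ≤ n := by exact_mod_cast hn
  have hk' : (0 : ℝ) < k := by exact_mod_cast hk
  have hkn' : (k : ℝ) ≤ n := by exact_mod_cast hkn
  have hp : (0 : ℝ) < Fintype.card I := by exact_mod_cast Fintype.card_pos
  have : Nonempty (Fin n) := ⟨⟨0, by omega⟩⟩
  obtain ⟨π, hπ, hπd⟩ := exists_nets (n := n) (k := k) (by omega) hk hU1
  set Λ := Real.log (4 * n) with hΛ
  have hΛ1 : 1 ≤ Λ := by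
    rw [hΛ, Real.le_log_iff_exp_le (by positivity)]
    linarith [Real.exp_one_lt_d9]
  set L := Nat.clog 2 n with hL
  have hLn : (n : ℝ) ≤ 2 ^ L := by exact_mod_cast Nat.le_pow_clog (by norm_num) n
  let Φ : ℕ → Type := fun l => Fin (4 ^ l) → (Fin n × Bool) × Bool
  set rad : ℕ → ℝ := fun l => 16 * √(k * Λ) / 2 ^ l with hrad
  have hrad0 : ∀ l, 0 ≤ rad l := fun l => by positivity
  set d : (l : ℕ) → Φ l × Φ (l + 1) → (Fin n → ℂ) := fun l s =>
    if ‖U *ᵥ (π (l + 1) s.2 - π l s.1)‖ ≤ 2 * rad l then π (l + 1) s.2 - π l s.1 else 0 with hd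
  have hdn : ∀ l s, ‖U *ᵥ d l s‖ ≤ 2 * rad l := by
    intro l s
    rw [hd]; dsimp only
    split_ifs with h
    · exact h
    · simpa using hrad0 l
  set f : (J → Bool) → (J → Bool) → (Fin n → ℂ) →ₗ[ℝ] (Fin n → ℂ) →ₗ[ℝ] ℝ :=
    fun δ δ' => (blockForm β w δ δ').compl₁₂ a b with hf
  set X₀ : (J → Bool) → (J → Bool) → ℝ := fun δ δ' =>
    ⨆ φ : Φ 0, |blockForm β w δ δ' (a (π 0 φ)) (b (π 0 φ))| with hX₀
  set X : ℕ → (J → Bool) → (J → Bool) → ℝ := fun l δ δ' =>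
    ⨆ s : Φ l × Φ (l + 1), |blockForm β w δ δ' (a (d l s)) (b (π (l + 1) s.2))| with hX
  set Y : ℕ → (J → Bool) → (J → Bool) → ℝ := fun l δ δ' =>
    ⨆ s : Φ l × Φ (l + 1), |blockForm β w δ δ' (a (π l s.1)) (b (d l s))| with hY
  set R : (J → Bool) → (J → Bool) → ℝ := fun δ δ' =>
    ⨆ s : (Fin n × Bool) × (Fin n × Bool),
      |blockForm β w δ δ' (a (realBasis s.1)) (b (realBasis s.2))| with hR
  set c := 2 * (√(2 * n) * rad L * √(2 * k)) with hc
  set G := √k * Λ / √(Fintype.card I) with hG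
  set Ma := 𝔼 δ, Qa δ with hMa
  set Mb := 𝔼 δ, Qb δ with hMb
  have hMa0 : 0 ≤ Ma := Finset.expect_nonneg fun δ _ => hQa0 δ
  have hMb0 : 0 ≤ Mb := Finset.expect_nonneg fun δ _ => hQb0 δ
  have hG0 : 0 ≤ G := by positivity
  have hsqΛ : √Λ * √Λ = Λ := Real.mul_self_sqrt (by linarith)
  have hsqΛ1 : 1 ≤ √Λ := Real.one_le_sqrt.2 hΛ1
  have hsqΛ' : √Λ ≤ Λ := by nlinarith
  have hradeq : ∀ l, rad l * 2 ^ l = 16 * (√k * √Λ) := by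
    intro l
    rw [hrad, ← Real.sqrt_mul hk'.le]
    field_simp
  have hfac : ∀ l, 2 * (2 * rad l) / √(Fintype.card I) * (4 * 2 ^ l * √Λ) = 256 * G := by
    intro l
    calc _ = 16 * (rad l * 2 ^ l) * √Λ / √(Fintype.card I) := by ring
      _ = 256 * (√k * (√Λ * √Λ)) / √(Fintype.card I) := by rw [hradeq]; ring
      _ = _ := by rw [hsqΛ, hG]; ring
  have hUT : ∀ x ∈ Tk n k, ‖U *ᵥ x‖ ≤ √(2 * k) := fun x hx =>
    (norm_mulVec_le_sum hU1 x).trans (sum_abs_realCoord_le_of_mem_Tk hx)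
  have hsq2 : √(2 : ℝ) ≤ 2 := by rw [Real.sqrt_le_left (by norm_num)]; norm_num
  have bX₀ : 𝔼 δ, 𝔼 δ', X₀ δ δ' ≤ 8 * G * Mb := by
    refine (expect_iSup_blockForm_le hw _ _ (τ := 2 * √(2 * k)) (by positivity)
      (fun s j => (ha _ j).trans (by linarith [hUT _ (hπ 0 s)])) hQb0
      (fun δ s => hQb δ _ (hπ 0 s))).trans ?_
    refine mul_le_mul_of_nonneg_right ?_ hMb0
    have h1 : √(2 * Real.log (2 * (Fintype.card (Φ 0)))) ≤ 2 * √Λ := by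
      rw [show 2 * √Λ = √(2 ^ 2 * Λ) by
        rw [Real.sqrt_mul (by norm_num), Real.sqrt_sq (by norm_num)]]
      refine Real.sqrt_le_sqrt ?_
      have h2 : (2 * (Fintype.card (Φ 0)) : ℝ) ≤ (4 * n) ^ 2 := by
        simp [Φ]; nlinarith
      have h3 := Real.log_le_log (by
        have := Fintype.card_pos (α := Φ 0)
        positivity) h2
      rw [Real.log_pow] at h3
      push_cast at h3
      linarith
    calc _ ≤ 2 * √(2 * k) / √(Fintype.card I) * (2 * √Λ) := by gcongr
      _ = (4 * √2 * √k * √Λ) / √(Fintype.card I) := by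
          rw [Real.sqrt_mul (by norm_num)]; ring
      _ ≤ (4 * 2 * √k * Λ) / √(Fintype.card I) := by gcongr
      _ = 8 * G := by rw [hG]; ring
  have bX : ∀ l, 𝔼 δ, 𝔼 δ', X l δ δ' ≤ 256 * G * Mb := by
    intro l
    refine (expect_iSup_blockForm_le hw _ _ (τ := 2 * (2 * rad l)) (by have := hrad0 l; positivity)
      (fun s j => (ha _ j).trans (by linarith [hdn l s])) hQb0
      (fun δ s => hQb δ _ (hπ _ _))).trans ?_
    refine mul_le_mul_of_nonneg_right ?_ hMb0
    rw [← hfac l]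
    exact mul_le_mul_of_nonneg_left (sqrt_log_net_pair_le hn l) (by have := hrad0 l; positivity)
  have bY : ∀ l, 𝔼 δ, 𝔼 δ', Y l δ δ' ≤ 256 * G * Ma := by
    intro l
    refine (expect_iSup_blockForm_le' hw _ _ (τ := 2 * (2 * rad l)) (by have := hrad0 l; positivity)
      (fun s j => (hb _ j).trans (by linarith [hdn l s])) hQa0
      (fun δ s => hQa δ _ (hπ _ _))).trans ?_
    refine mul_le_mul_of_nonneg_right ?_ hMa0
    rw [← hfac l]
    exact mul_le_mul_of_nonneg_left (sqrt_log_net_pair_le hn l) (by have := hrad0 l; positivity)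
  have bR : c * 𝔼 δ, 𝔼 δ', R δ δ' ≤ 256 * G * Mb := by
    have h1 := expect_iSup_blockForm_le hw
      (fun s : (Fin n × Bool) × (Fin n × Bool) => a (realBasis s.1)) (fun s => b (realBasis s.2))
      (τ := 2) (by norm_num)
      (fun s j => (ha _ j).trans (by linarith [norm_mulVec_realBasis_le hU1 s.1])) hQb0
      (fun δ s => hQb δ _ (realBasis_mem_Tk hk _))
    have h2 : √(2 * Real.log (2 * (Fintype.card ((Fin n × Bool) × (Fin n × Bool))))) ≤ 2 * √Λ := by
      rw [show 2 * √Λ = √(2 ^ 2 * Λ) by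
        rw [Real.sqrt_mul (by norm_num), Real.sqrt_sq (by norm_num)]]
      refine Real.sqrt_le_sqrt ?_
      have h2 : (2 * (Fintype.card ((Fin n × Bool) × (Fin n × Bool))) : ℝ) ≤ (4 * n) ^ 2 := by
        simp; nlinarith
      have h3 := Real.log_le_log (by
        have := Fintype.card_pos (α := (Fin n × Bool) × (Fin n × Bool))
        positivity) h2
      rw [Real.log_pow] at h3
      push_cast at h3
      linarith
    have hc0 : 0 ≤ c := by have := hrad0 L; positivity
    have hcle : c ≤ 64 * (√k * √Λ) := by
      have e : c = 4 * (√n * √k) * rad L := by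
        rw [hc, Real.sqrt_mul (by norm_num), Real.sqrt_mul (by norm_num)]
        linear_combination (2 * √n * √k * rad L) * Real.mul_self_sqrt (show (0 : ℝ) ≤ 2 by norm_num)
      have hs : √n * √k ≤ 2 ^ L := by
        have : √(k : ℝ) ≤ √n := Real.sqrt_le_sqrt hkn'
        have h3 := Real.mul_self_sqrt (show (0 : ℝ) ≤ n by positivity)
        nlinarith [Real.sqrt_nonneg (n : ℝ)]
      rw [e]
      have := mul_le_mul_of_nonneg_right hs (hrad0 L)
      linarith [hradeq L]
    calc c * 𝔼 δ, 𝔼 δ', R δ δ' ≤ c * (2 / √(Fintype.card I) * (2 * √Λ) * Mb) := by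
          refine mul_le_mul_of_nonneg_left (h1.trans ?_) hc0
          gcongr
      _ ≤ 64 * (√k * √Λ) * (2 / √(Fintype.card I) * (2 * √Λ) * Mb) := by gcongr
      _ = 256 * (√k * (√Λ * √Λ) / √(Fintype.card I)) * Mb := by ring
      _ = _ := by rw [hsqΛ]
  refine ⟨fun δ δ' => X₀ δ δ' + ∑ l ∈ Finset.range L, (X l δ δ' + Y l δ δ') + c * R δ δ', ?_, ?_⟩
  · intro δ δ' x hx
    choose ψ hψ using fun l => hπd l x hx
    have hR' : ∀ s t, |f δ δ' (realBasis s) (realBasis t)| ≤ R δ δ' := fun s t =>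
      le_ciSup (f := fun s : (Fin n × Bool) × (Fin n × Bool) =>
        |blockForm β w δ δ' (a (realBasis s.1)) (b (realBasis s.2))|)
        (Set.finite_range _).bddAbove (s, t)
    have hR0 : 0 ≤ R δ δ' := Real.iSup_nonneg fun _ => abs_nonneg _
    have hΔ : ∑ s, |realCoord (x - π L (ψ L)) s| ≤ √(2 * n) * rad L := by
      refine (sum_abs_realCoord_le _ Finset.univ (by simp)).trans ?_
      rw [Finset.card_univ, Fintype.card_fin]
      gcongr
      exact (norm2C_le_norm_mulVec (by omega) hU _).trans (hψ L)
    have hdiff : ∀ l, d l (ψ l, ψ (l + 1)) = π (l + 1) (ψ (l + 1)) - π l (ψ l) := by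
      intro l
      rw [hd]
      refine if_pos ?_
      dsimp only
      rw [← sub_sub_sub_cancel_left _ _ x, Matrix.mulVec_sub]
      refine (norm_sub_le _ _).trans ?_
      have h1 : rad (l + 1) ≤ rad l := by
        simp only [hrad]
        gcongr <;> norm_num
      have h2 : ‖U *ᵥ (x - π l (ψ l))‖ ≤ rad l := hψ l
      have h3 : ‖U *ᵥ (x - π (l + 1) (ψ (l + 1)))‖ ≤ rad (l + 1) := hψ (l + 1)
      linarith
    refine (abs_bilin_diag_le_chain (f δ δ') x (fun l => π l (ψ l)) L).trans ?_
    refine add_le_add (add_le_add ?_ (Finset.sum_le_sum fun l _ => add_le_add ?_ ?_)) ?_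
    · exact le_ciSup (f := fun φ : Φ 0 => |blockForm β w δ δ' (a (π 0 φ)) (b (π 0 φ))|)
        (Set.finite_range _).bddAbove (ψ 0)
    · rw [← hdiff]
      exact le_ciSup (f := fun s : Φ l × Φ (l + 1) =>
        |blockForm β w δ δ' (a (d l s)) (b (π (l + 1) s.2))|)
        (Set.finite_range _).bddAbove (ψ l, ψ (l + 1))
    · rw [← hdiff]
      exact le_ciSup (f := fun s : Φ l × Φ (l + 1) =>
        |blockForm β w δ δ' (a (π l s.1)) (b (d l s))|)
        (Set.finite_range _).bddAbove (ψ l, ψ (l + 1))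
    · have h1 := abs_bilin_le (f δ δ') (x - π L (ψ L)) x hR'
      have h2 := abs_bilin_le (f δ δ') (π L (ψ L)) (x - π L (ψ L)) hR'
      have h3 : (∑ s, |realCoord (x - π L (ψ L)) s|) * (∑ s, |realCoord x s|) * R δ δ' ≤
          √(2 * n) * rad L * √(2 * k) * R δ δ' := by
        have := sum_abs_realCoord_le_of_mem_Tk hx
        have := hrad0 L
        gcongr
      have h4 : (∑ s, |realCoord (π L (ψ L)) s|) * (∑ s, |realCoord (x - π L (ψ L)) s|) * R δ δ' ≤
          √(2 * k) * (√(2 * n) * rad L) * R δ δ' := by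
        have := sum_abs_realCoord_le_of_mem_Tk (hπ L (ψ L))
        gcongr
      rw [hc]
      linarith
  · simp only [Finset.expect_add_distrib, Finset.expect_sum_comm, ← Finset.mul_expect]
    have hsum : ∑ l ∈ Finset.range L, (𝔼 δ, 𝔼 δ', X l δ δ' + 𝔼 δ, 𝔼 δ', Y l δ δ') ≤
        L * (256 * G * (Ma + Mb)) := by
      refine (Finset.sum_le_sum (g := fun _ => 256 * G * (Ma + Mb)) fun l _ => ?_).trans
        (le_of_eq (by simp))
      linarith [bX l, bY l]
    have hlog2 : 0.69 < Real.log 2 := by linarith [Real.log_two_gt_d9]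
    have hlogn : Real.log 2 ≤ Real.log n := Real.log_le_log (by norm_num) hn'
    have hΛn : Λ ≤ 3 * Real.log n := log_four_mul_le hn
    have hLle : (L : ℝ) ≤ 3 * Real.log n := clog_two_le hn
    have hM : 0 ≤ Ma + Mb := by linarith
    have htot : 𝔼 δ, 𝔼 δ', X₀ δ δ' +
        ∑ l ∈ Finset.range L, (𝔼 δ, 𝔼 δ', X l δ δ' + 𝔼 δ, 𝔼 δ', Y l δ δ') +
        c * 𝔼 δ, 𝔼 δ', R δ δ' ≤ (264 + 256 * L) * G * (Ma + Mb) := by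
      have : 0 ≤ 264 * G * Ma := by positivity
      linarith
    refine htot.trans (mul_le_mul_of_nonneg_right ?_ hM)
    have h1 : 264 + 256 * (L : ℝ) ≤ 1200 * Real.log n := by linarith
    calc (264 + 256 * (L : ℝ)) * G
        ≤ 1200 * Real.log n * (√k * (3 * Real.log n) / √(Fintype.card I)) := by
          rw [hG]
          have : 0 ≤ Real.log n := by linarith
          gcongr
      _ = 3600 * (√k * Real.log n ^ 2 / √(Fintype.card I)) := by ring
      _ ≤ _ := by gcongr; norm_num
end Chain

section Symmetrization
variable {I J : Type*}

lemma rsign_beq (b c : Bool) : rsign (b == c) = rsign b * rsign c := by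
  cases b <;> cases c <;> simp [rsign]

lemma rsign_mul_self (b : Bool) : rsign b * rsign b = 1 := by
  cases b <;> simp [rsign]

/-- Exchange the `j`-th samples of two sign-sample families where `δ j ≠ δ' j`, and flip both signs
where `δ' j` is negative. -/
def exchange {κ : Type*} (δ δ' : J → Bool) (q : ((J → κ) × (J → Bool)) × ((J → κ) × (J → Bool))) :
    ((J → κ) × (J → Bool)) × ((J → κ) × (J → Bool)) :=
  ((fun j => if δ j = δ' j then q.1.1 j else q.2.1 j,
    fun j => (if δ j = δ' j then q.1.2 j else q.2.2 j) == δ' j),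
   (fun j => if δ j = δ' j then q.2.1 j else q.1.1 j,
    fun j => (if δ j = δ' j then q.2.2 j else q.1.2 j) == δ' j))

lemma exchange_involutive {κ : Type*} (δ δ' : J → Bool) :
    Function.Involutive (exchange (κ := κ) δ δ') := by
  rintro ⟨⟨r, e⟩, r', e'⟩
  simp only [exchange, Prod.mk.injEq]
  refine ⟨⟨?_, ?_⟩, ?_, ?_⟩ <;> funext j <;> by_cases h : δ j = δ' j <;> simp [h]

/-- The signed combination `±(U x)_{r_j} + c (±(U x)_{r'_j})` of two families of samples. -/
def combine {n : ℕ} (U : Matrix (Fin n) (Fin n) ℂ) (c : ℝ)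
    (q : ((J → Fin n) × (J → Bool)) × ((J → Fin n) × (J → Bool))) :
    (Fin n → ℂ) →ₗ[ℝ] (J → ℂ) where
  toFun x j := rsign (q.1.2 j) * (U *ᵥ x) (q.1.1 j) + c * (rsign (q.2.2 j) * (U *ᵥ x) (q.2.1 j))
  map_add' x y := by
    funext j
    simp only [Matrix.mulVec_add, Pi.add_apply]
    ring
  map_smul' r x := by
    funext j
    simp only [Matrix.mulVec_smul, Pi.smul_apply, Complex.real_smul, RingHom.id_apply]
    ring

lemma combine_apply {n : ℕ} (U : Matrix (Fin n) (Fin n) ℂ) (c : ℝ)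
    (q : ((J → Fin n) × (J → Bool)) × ((J → Fin n) × (J → Bool))) (x : Fin n → ℂ) (j : J) :
    combine U c q x j =
      rsign (q.1.2 j) * (U *ᵥ x) (q.1.1 j) + c * (rsign (q.2.2 j) * (U *ᵥ x) (q.2.1 j)) := rfl

lemma norm_combine_le {n : ℕ} (U : Matrix (Fin n) (Fin n) ℂ) {c : ℝ} (hc : |c| ≤ 1)
    (q : ((J → Fin n) × (J → Bool)) × ((J → Fin n) × (J → Bool))) (x : Fin n → ℂ) (j : J) :
    ‖combine U c q x j‖ ≤ 2 * ‖U *ᵥ x‖ := by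
  have h : ∀ b t, ‖(rsign b : ℂ) * (U *ᵥ x) t‖ ≤ ‖U *ᵥ x‖ := by
    intro b t
    rw [norm_mul, Complex.norm_real]
    have h1 : ‖rsign b‖ = 1 := by cases b <;> simp [rsign]
    rw [h1, one_mul]
    exact norm_le_pi_norm _ _
  rw [combine_apply, two_mul]
  refine norm_add_le_of_le (h _ _) ?_
  rw [norm_mul, Complex.norm_real, Real.norm_eq_abs]
  exact (mul_le_of_le_one_left (norm_nonneg _) hc).trans (h _ _)

variable [Fintype J]

lemma expect_rsign_mul_rsign [DecidableEq J] (j j' : J) :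
    𝔼 δ : J → Bool, rsign (δ j) * rsign (δ j') = if j = j' then 1 else 0 := by
  split_ifs with h
  · subst h
    simp only [rsign_mul_self]
    exact Fintype.expect_const 1
  · have hinv : Function.Involutive fun δ : J → Bool => Function.update δ j (!δ j) := by
      intro δ
      simp
    have := Fintype.expect_equiv hinv.toPerm (fun δ => rsign (δ j) * rsign (δ j'))
      (fun δ => -(rsign (δ j) * rsign (δ j'))) fun δ => by
        have h' : j' ≠ j := Ne.symm h
        cases hj : δ j <;> cases hj' : δ j' <;> simp [h', hj, hj', rsign]
    rw [Finset.expect_neg_distrib] at this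
    linarith

lemma expect_sq_sum_rsign [DecidableEq J] (t : Finset J) (c : J → ℝ) :
    𝔼 δ : J → Bool, (∑ j ∈ t, rsign (δ j) * c j) ^ 2 = ∑ j ∈ t, c j ^ 2 := by
  have e : ∀ δ : J → Bool, (∑ j ∈ t, rsign (δ j) * c j) ^ 2 =
      ∑ j ∈ t, ∑ j' ∈ t, (rsign (δ j) * rsign (δ j')) * (c j * c j') := by
    intro δ
    rw [sq, Finset.sum_mul_sum]
    exact Finset.sum_congr rfl fun j _ => Finset.sum_congr rfl fun j' _ => by ring
  simp only [e, Finset.expect_sum_comm, ← Finset.expect_mul, expect_rsign_mul_rsign]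
  refine Finset.sum_congr rfl fun j hj => ?_
  simp [hj, sq]

lemma expect_comp_eval [DecidableEq J] {κ : Type*} [Fintype κ] [Nonempty κ] (g : κ → ℝ) (j : J) :
    𝔼 r : J → κ, g (r j) = 𝔼 t, g t := by
  classical
  rw [Fintype.expect_equiv (Equiv.funSplitAt j κ) (fun r => g (r j)) (fun q => g q.1)
    fun r => rfl, ← Finset.univ_product_univ, Finset.expect_product]
  simp

lemma expect_exchange {κ : Type*} [Fintype κ] [DecidableEq J] (δ δ' : J → Bool)
    (g : ((J → κ) × (J → Bool)) × ((J → κ) × (J → Bool)) → ℝ) :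
    𝔼 q, g (exchange δ δ' q) = 𝔼 q, g q :=
  Fintype.expect_equiv (exchange_involutive δ δ').toPerm _ _ fun _ => rfl

variable [DecidableEq I]

/-- The block sums of the signed samples. -/
def sampleSum {n : ℕ} (U : Matrix (Fin n) (Fin n) ℂ) (β : J → I) (w : J → ℝ)
    (ω : (J → Fin n) × (J → Bool)) (x : Fin n → ℂ) (i : I) : ℂ :=
  blockSum β w ω.2 (fun j => (U *ᵥ x) (ω.1 j)) i

lemma blockSum_combine_neg_one {n : ℕ} (U : Matrix (Fin n) (Fin n) ℂ) (β : J → I) (w : J → ℝ)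
    (q : ((J → Fin n) × (J → Bool)) × ((J → Fin n) × (J → Bool))) (δ δ' : J → Bool)
    (x : Fin n → ℂ) (i : I) :
    blockSum β w δ (combine U (-1) q x) i =
      sampleSum U β w (exchange δ δ' q).1 x i - sampleSum U β w (exchange δ δ' q).2 x i := by
  simp only [sampleSum, blockSum, ← Finset.sum_sub_distrib]
  refine Finset.sum_congr rfl fun j _ => ?_
  simp only [combine_apply, exchange, rsign_beq]
  by_cases h : δ j = δ' j
  · simp only [h, if_true]
    push_cast
    ring
  · have h2 : rsign (δ j) = -rsign (δ' j) := by
      revert h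
      cases δ j <;> cases δ' j <;> simp [rsign]
    simp only [h, if_false, h2]
    push_cast
    ring

lemma blockSum_combine_one {n : ℕ} (U : Matrix (Fin n) (Fin n) ℂ) (β : J → I) (w : J → ℝ)
    (q : ((J → Fin n) × (J → Bool)) × ((J → Fin n) × (J → Bool))) (δ δ' : J → Bool)
    (x : Fin n → ℂ) (i : I) :
    blockSum β w δ' (combine U 1 q x) i =
      sampleSum U β w (exchange δ δ' q).1 x i + sampleSum U β w (exchange δ δ' q).2 x i := by
  simp only [sampleSum, blockSum, ← Finset.sum_add_distrib]
  refine Finset.sum_congr rfl fun j _ => ?_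
  simp only [combine_apply, exchange, rsign_beq]
  by_cases h : δ j = δ' j
  · simp only [h, if_true]
    push_cast
    ring
  · simp only [h, if_false]
    push_cast
    ring

variable [Fintype I]

lemma expect_blockEnergy [DecidableEq J] (β : J → I) (w : J → ℝ) (y : J → ℂ) :
    𝔼 δ, blockEnergy β w δ y =
      (∑ i, ∑ j with β j = i, w j ^ 2 * ‖y j‖ ^ 2) / Fintype.card I := by
  simp only [blockEnergy, ← Finset.expect_div, Finset.expect_sum_comm]
  congr 1
  refine Finset.sum_congr rfl fun i _ => ?_
  have e : ∀ δ, ‖blockSum β w δ y i‖ ^ 2 =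
      (∑ j with β j = i, rsign (δ j) * (w j * (y j).re)) ^ 2 +
      (∑ j with β j = i, rsign (δ j) * (w j * (y j).im)) ^ 2 := by
    intro δ
    rw [Complex.sq_norm, Complex.normSq_apply, blockSum, Complex.re_sum, Complex.im_sum, sq, sq]
    simp only [Complex.re_ofReal_mul, Complex.im_ofReal_mul]
    congr 2 <;> exact Finset.sum_congr rfl fun j _ => by ring
  simp only [e, Finset.expect_add_distrib, expect_sq_sum_rsign, ← Finset.sum_add_distrib]
  refine Finset.sum_congr rfl fun j _ => ?_
  rw [Complex.sq_norm, Complex.normSq_apply]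
  ring

/-- The normalized energy of the block sums of the signed samples of `U *ᵥ x` selected by `ω`. -/
def sampleEnergy {n : ℕ} (U : Matrix (Fin n) (Fin n) ℂ) (β : J → I) (w : J → ℝ)
    (ω : (J → Fin n) × (J → Bool)) (x : Fin n → ℂ) : ℝ :=
  blockEnergy β w ω.2 fun j => (U *ᵥ x) (ω.1 j)

lemma blockEnergy_nonneg (β : J → I) (w : J → ℝ) (δ : J → Bool) (y : J → ℂ) :
    0 ≤ blockEnergy β w δ y := by
  unfold blockEnergy
  positivity

lemma expect_sampleEnergy [DecidableEq J] [Nonempty I] {n : ℕ} (hn : 0 < n)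
    {U : Matrix (Fin n) (Fin n) ℂ} (hU : Uᴴ * U = (n : ℂ) • (1 : Matrix (Fin n) (Fin n) ℂ))
    {β : J → I} {w : J → ℝ} (hw : ∀ i, ∑ j with β j = i, w j ^ 2 = 1) (x : Fin n → ℂ) :
    𝔼 ω, sampleEnergy U β w ω x = norm2C x ^ 2 := by
  have : Nonempty (Fin n) := ⟨⟨0, hn⟩⟩
  have hp : (Fintype.card I : ℝ) ≠ 0 := by exact_mod_cast Fintype.card_ne_zero
  rw [← Finset.univ_product_univ, Finset.expect_product]
  simp only [sampleEnergy, expect_blockEnergy, ← Finset.expect_div, Finset.expect_sum_comm,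
    ← Finset.mul_expect]
  have h : ∀ j : J, 𝔼 r : J → Fin n, ‖(U *ᵥ x) (r j)‖ ^ 2 = norm2C x ^ 2 := by
    intro j
    rw [expect_comp_eval (fun t => ‖(U *ᵥ x) t‖ ^ 2) j, Fintype.expect_eq_sum_div_card,
      sum_norm_mulVec_sq hU, Fintype.card_fin]
    field_simp
  simp only [h, ← Finset.sum_mul, hw]
  simp

lemma exists_sampleEnergy_le {n k : ℕ} {U : Matrix (Fin n) (Fin n) ℂ} (hU1 : ∀ i j, ‖U i j‖ ≤ 1)
    (β : J → I) (w : J → ℝ) : ∃ K, ∀ ω, ∀ x ∈ Tk n k, sampleEnergy U β w ω x ≤ K := by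
  refine ⟨(∑ i, (∑ j with β j = i, |w j| * √(2 * k)) ^ 2) / Fintype.card I, fun ω x hx => ?_⟩
  unfold sampleEnergy blockEnergy
  gcongr with i
  refine norm_sum_le_of_le _ fun j _ => ?_
  rw [norm_mul, Complex.norm_real, norm_mul, Real.norm_eq_abs]
  have h1 : ‖rsign (ω.2 j)‖ = 1 := by cases ω.2 j <;> simp [rsign]
  rw [h1, mul_one]
  gcongr
  exact (norm_le_pi_norm _ _).trans
    ((norm_mulVec_le_sum hU1 x).trans (sum_abs_realCoord_le_of_mem_Tk hx))

lemma sampleEnergy_exchange_sub {n : ℕ} (U : Matrix (Fin n) (Fin n) ℂ) (β : J → I) (w : J → ℝ)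
    (q : ((J → Fin n) × (J → Bool)) × ((J → Fin n) × (J → Bool))) (δ δ' : J → Bool)
    (x : Fin n → ℂ) :
    sampleEnergy U β w (exchange δ δ' q).1 x - sampleEnergy U β w (exchange δ δ' q).2 x =
      blockForm β w δ δ' (combine U (-1) q x) (combine U 1 q x) := by
  rw [blockForm_apply, sampleEnergy, sampleEnergy, blockEnergy, blockEnergy, ← sub_div,
    ← Finset.sum_sub_distrib]
  congr 1
  refine Finset.sum_congr rfl fun i _ => ?_
  rw [blockSum_combine_neg_one U β w q δ δ', blockSum_combine_one U β w q δ δ',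
    Complex.sq_norm, Complex.sq_norm, Complex.normSq_apply, Complex.normSq_apply]
  simp only [sampleSum, star_add, Complex.mul_re, Complex.sub_re, Complex.sub_im, Complex.add_re,
    Complex.add_im, Complex.star_def, Complex.conj_re, Complex.conj_im]
  ring

lemma blockEnergy_le_two_mul {n : ℕ} {U : Matrix (Fin n) (Fin n) ℂ} {β : J → I} {w : J → ℝ}
    {δ : J → Bool} {y : J → ℂ} {ω ω' : (J → Fin n) × (J → Bool)} {x : Fin n → ℂ}
    (h : ∀ i, ‖blockSum β w δ y i‖ ≤ ‖sampleSum U β w ω x i‖ + ‖sampleSum U β w ω' x i‖) :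
    blockEnergy β w δ y ≤ 2 * sampleEnergy U β w ω x + 2 * sampleEnergy U β w ω' x := by
  unfold sampleEnergy blockEnergy
  rw [← mul_div_assoc, ← mul_div_assoc, ← add_div, Finset.mul_sum, Finset.mul_sum,
    ← Finset.sum_add_distrib]
  gcongr with i
  change _ ≤ 2 * ‖sampleSum U β w ω x i‖ ^ 2 + 2 * ‖sampleSum U β w ω' x i‖ ^ 2
  have := pow_le_pow_left₀ (norm_nonneg _) (h i) 2
  nlinarith [sq_nonneg (‖sampleSum U β w ω x i‖ - ‖sampleSum U β w ω' x i‖)]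
end Symmetrization

lemma expect_prod_type {A B : Type*} [Fintype A] [Fintype B] (g : A × B → ℝ) :
    𝔼 q, g q = 𝔼 a, 𝔼 b, g (a, b) := by
  rw [← Finset.univ_product_univ, Finset.expect_product]

lemma expect_rotate {A B C : Type*} [Fintype A] [Fintype B] [Fintype C] (g : A → B → C → ℝ) :
    𝔼 c, 𝔼 a, 𝔼 b, g a b c = 𝔼 a, 𝔼 b, 𝔼 c, g a b c := by
  rw [Finset.expect_comm]
  exact Finset.expect_congr rfl fun a _ => Finset.expect_comm _ _ _

section Main
variable {I J : Type*} [Fintype I] [DecidableEq I] [Fintype J] [DecidableEq J]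

/-- The expected uniform deviation of the sample energy over sparse vectors satisfies a
self-bounding inequality. -/
lemma expect_iSup_sampleEnergy_sub_le [Nonempty I] {n k : ℕ} (hn : 2 ≤ n) (hk : 0 < k)
    (hkn : k ≤ n) {U : Matrix (Fin n) (Fin n) ℂ}
    (hU : Uᴴ * U = (n : ℂ) • (1 : Matrix (Fin n) (Fin n) ℂ)) (hU1 : ∀ i j, ‖U i j‖ ≤ 1)
    {β : J → I} {w : J → ℝ} (hw : ∀ i, ∑ j with β j = i, w j ^ 2 = 1) :
    𝔼 ω, (⨆ x : Tk n k, |sampleEnergy U β w ω x - norm2C (x : Fin n → ℂ) ^ 2|) ≤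
      5000 * (√k * Real.log n ^ 2 / √(Fintype.card I)) *
        (5 + 4 * 𝔼 ω, ⨆ x : Tk n k, |sampleEnergy U β w ω x - norm2C (x : Fin n → ℂ) ^ 2|) := by
  have : Nonempty (Fin n) := ⟨⟨0, by omega⟩⟩
  have : Nonempty (Tk n k) := ⟨⟨_, realBasis_mem_Tk hk (⟨0, by omega⟩, true)⟩⟩
  obtain ⟨K, hK⟩ := exists_sampleEnergy_le (k := k) hU1 β w
  have hF0 : ∀ ω x, 0 ≤ sampleEnergy U β w ω x := fun ω x => blockEnergy_nonneg _ _ _ _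
  set S : (J → Fin n) × (J → Bool) → ℝ := fun ω =>
    ⨆ x : Tk n k, |sampleEnergy U β w ω x - norm2C (x : Fin n → ℂ) ^ 2| with hS
  set T : ((J → Fin n) × (J → Bool)) × ((J → Fin n) × (J → Bool)) → ℝ := fun q =>
    ⨆ x : Tk n k, |sampleEnergy U β w q.1 x - sampleEnergy U β w q.2 x| with hT
  set Γ := 5000 * (√k * Real.log n ^ 2 / √(Fintype.card I)) with hΓ
  have hS0 : ∀ ω, 0 ≤ S ω := fun ω => Real.iSup_nonneg fun _ => abs_nonneg _
  have hSle : ∀ ω, ∀ x ∈ Tk n k, sampleEnergy U β w ω x ≤ 1 + S ω := by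
    intro ω x hx
    have hb : BddAbove (Set.range fun x : Tk n k =>
        |sampleEnergy U β w ω x - norm2C (x : Fin n → ℂ) ^ 2|) := by
      refine ⟨K + 1, ?_⟩
      rintro _ ⟨y, rfl⟩
      dsimp only
      rw [y.2.1, abs_le]
      constructor <;> linarith [hF0 ω y, hK ω y y.2]
    have h1 := le_ciSup hb ⟨x, hx⟩
    have h2 := (le_abs_self _).trans h1
    dsimp only at h2
    rw [hx.1] at h2
    linarith
  have hST : ∀ ω, S ω ≤ 𝔼 ω', T (ω, ω') := by
    intro ω
    refine ciSup_le fun x => ?_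
    rw [← expect_sampleEnergy (by omega) hU hw,
      ← Fintype.expect_const (ι := (J → Fin n) × (J → Bool)) (sampleEnergy U β w ω x),
      ← Finset.expect_sub_distrib]
    refine (Finset.abs_expect_le _ _).trans (Finset.expect_le_expect fun ω' _ => ?_)
    refine le_ciSup (f := fun x : Tk n k =>
      |sampleEnergy U β w ω x - sampleEnergy U β w ω' x|) ⟨K, ?_⟩ x
    rintro _ ⟨y, rfl⟩
    dsimp only
    rw [abs_le]
    constructor <;> linarith [hF0 ω y, hK ω y y.2, hF0 ω' y, hK ω' y y.2]
  set Q : ((J → Fin n) × (J → Bool)) × ((J → Fin n) × (J → Bool)) → (J → Bool) → ℝ := fun q δ =>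
    5 / 2 + S (exchange δ δ q).1 + S (exchange δ δ q).2 with hQ
  have hQ0 : ∀ q δ, 0 ≤ Q q δ := fun q δ => by
    have h1 := hS0 (exchange δ δ q).1
    have h2 := hS0 (exchange δ δ q).2
    simp only [hQ]
    linarith
  have hQle : ∀ q δ, ∀ x ∈ Tk n k, 2 * sampleEnergy U β w (exchange δ δ q).1 x +
      2 * sampleEnergy U β w (exchange δ δ q).2 x ≤ Q q δ ^ 2 := by
    intro q δ x hx
    have h1 := hSle (exchange δ δ q).1 x hx
    have h2 := hSle (exchange δ δ q).2 x hx
    set A := sampleEnergy U β w (exchange δ δ q).1 x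
    set B := sampleEnergy U β w (exchange δ δ q).2 x
    have hA : 0 ≤ A := hF0 _ _
    have hB : 0 ≤ B := hF0 _ _
    have h3 : 1 / 2 + A + B ≤ Q q δ := by simp only [hQ]; linarith
    nlinarith [sq_nonneg (A + B - 1 / 2)]
  have hex : ∀ q, ∃ W : (J → Bool) → (J → Bool) → ℝ,
      (∀ δ δ', T (exchange δ δ' q) ≤ W δ δ') ∧
      𝔼 δ, 𝔼 δ', W δ δ' ≤ Γ * ((𝔼 δ, Q q δ) + 𝔼 δ, Q q δ) := by
    intro q
    obtain ⟨W, hW1, hW2⟩ := exists_chaos_bound hn hk hkn hU hU1 hw (combine U (-1) q)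
      (combine U 1 q) (norm_combine_le U (by simp) q) (norm_combine_le U (by simp) q)
      (hQ0 q) (hQ0 q)
      (fun δ x hx => (blockEnergy_le_two_mul fun i => by
        rw [blockSum_combine_neg_one U β w q δ δ]
        exact norm_sub_le _ _).trans (hQle q δ x hx))
      (fun δ x hx => (blockEnergy_le_two_mul fun i => by
        rw [blockSum_combine_one U β w q δ δ]
        exact norm_add_le _ _).trans (hQle q δ x hx))
    refine ⟨W, fun δ δ' => ciSup_le fun x => ?_, hW2⟩
    rw [sampleEnergy_exchange_sub]
    exact hW1 δ δ' x x.2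
  have hfst : 𝔼 q : ((J → Fin n) × (J → Bool)) × ((J → Fin n) × (J → Bool)), S q.1 = 𝔼 ω, S ω := by
    simp [expect_prod_type]
  have hsnd : 𝔼 q : ((J → Fin n) × (J → Bool)) × ((J → Fin n) × (J → Bool)), S q.2 = 𝔼 ω, S ω := by
    simp [expect_prod_type]
  have hQexp : 𝔼 q, 𝔼 δ, Q q δ = 5 / 2 + 2 * 𝔼 ω, S ω := by
    rw [Finset.expect_comm]
    have : ∀ δ, 𝔼 q, Q q δ = 5 / 2 + 2 * 𝔼 ω, S ω := by
      intro δ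
      simp only [hQ]
      rw [expect_exchange δ δ fun q => 5 / 2 + S q.1 + S q.2, Finset.expect_add_distrib,
        Finset.expect_add_distrib, hfst, hsnd, Fintype.expect_const]
      ring
    simp only [this]
    exact Fintype.expect_const _
  calc 𝔼 ω, S ω ≤ 𝔼 ω, 𝔼 ω', T (ω, ω') := Finset.expect_le_expect fun ω _ => hST ω
    _ = 𝔼 q, T q := (expect_prod_type T).symm
    _ = 𝔼 δ : J → Bool, 𝔼 δ' : J → Bool, 𝔼 q, T (exchange δ δ' q) := by
        simp only [expect_exchange]
        rw [Fintype.expect_const, Fintype.expect_const]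
    _ = 𝔼 q, 𝔼 δ : J → Bool, 𝔼 δ' : J → Bool, T (exchange δ δ' q) := (expect_rotate _).symm
    _ ≤ 𝔼 q, Γ * ((𝔼 δ, Q q δ) + 𝔼 δ, Q q δ) := by
        refine Finset.expect_le_expect fun q _ => ?_
        obtain ⟨W, hW1, hW2⟩ := hex q
        exact (Finset.expect_le_expect fun δ _ => Finset.expect_le_expect fun δ' _ =>
          hW1 δ δ').trans hW2
    _ = Γ * (5 + 4 * 𝔼 ω, S ω) := by
        rw [← Finset.mul_expect, Finset.expect_add_distrib, hQexp]
        ring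
end Main

lemma sum_sq_block (p : ℕ) {lam : ℕ} (f : Fin lam → ℝ) (i : Fin p) :
    ∑ j : Fin (p * lam) with j.divNat = i, f j.modNat = ∑ t, f t := by
  rw [Finset.sum_filter, ← Equiv.sum_comp finProdFinEquiv, Fintype.sum_prod_type]
  have : ∀ (a : Fin p) (t : Fin lam), (finProdFinEquiv (a, t)).divNat = a ∧
      (finProdFinEquiv (a, t)).modNat = t := by
    intro a t
    have := finProdFinEquiv.symm_apply_apply (a, t)
    rw [finProdFinEquiv_symm_apply, Prod.mk.injEq] at this
    exact this
  simp only [this]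
  rw [Finset.sum_eq_single i] <;> simp +contextual

lemma norm2_pos {lam : ℕ} {v : Fin lam → ℝ} (hv : v ≠ 0) : 0 < norm2 v := by
  obtain ⟨t, ht⟩ := Function.ne_iff.1 hv
  refine Real.sqrt_pos.2 (Finset.sum_pos' (fun _ _ => sq_nonneg _) ⟨t, Finset.mem_univ _, ?_⟩)
  have : v t ≠ 0 := ht
  positivity

lemma sum_sq_block_normalized (p : ℕ) {lam : ℕ} {v : Fin lam → ℝ} (hv : v ≠ 0) (i : Fin p) :
    ∑ j : Fin (p * lam) with j.divNat = i, (v j.modNat / norm2 v) ^ 2 = 1 := by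
  rw [sum_sq_block p (fun t => (v t / norm2 v) ^ 2) i]
  have h := norm2_pos hv
  have h2 : norm2 v ^ 2 = ∑ t, v t ^ 2 := Real.sq_sqrt (Finset.sum_nonneg fun _ _ => sq_nonneg _)
  simp only [div_pow, ← Finset.sum_div]
  rw [← h2]
  field_simp

lemma norm2C_sq_eq_sampleEnergy {n p lam : ℕ} (v : Fin lam → ℝ) (U : Matrix (Fin n) (Fin n) ℂ)
    (ω : (Fin (p * lam) → Fin n) × (Fin (p * lam) → Bool)) (x : Fin n → ℂ) :
    (norm2C (((((1 / (norm2 v * Real.sqrt p)) • kronRow p v).map Complex.ofReal) *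
      Matrix.of fun j t => ((rsign (ω.2 j) : ℝ) : ℂ) * U (ω.1 j) t).mulVec x)) ^ 2 =
    sampleEnergy U Fin.divNat (fun j : Fin (p * lam) => v j.modNat / norm2 v) ω x := by
  rw [norm2C_sq, sampleEnergy, blockEnergy, Finset.sum_div, Fintype.card_fin]
  refine Finset.sum_congr rfl fun i _ => ?_
  rw [← Matrix.mulVec_mulVec]
  have h1 : (Matrix.of fun j t => ((rsign (ω.2 j) : ℝ) : ℂ) * U (ω.1 j) t) *ᵥ x =
      fun j => (rsign (ω.2 j) : ℂ) * (U *ᵥ x) (ω.1 j) := by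
    funext j
    simp [Matrix.mulVec, dotProduct, Finset.mul_sum, mul_assoc]
  have h2 : ((((1 / (norm2 v * Real.sqrt p)) • kronRow p v).map Complex.ofReal) *ᵥ
      fun j => (rsign (ω.2 j) : ℂ) * (U *ᵥ x) (ω.1 j)) i =
      ((1 / √p : ℝ) : ℂ) * blockSum Fin.divNat (fun j : Fin (p * lam) => v j.modNat / norm2 v)
        ω.2 (fun j => (U *ᵥ x) (ω.1 j)) i := by
    rw [blockSum, Finset.sum_filter, Finset.mul_sum, Matrix.mulVec, dotProduct]
    refine Finset.sum_congr rfl fun j _ => ?_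
    have hlam : 0 < lam := Nat.pos_of_ne_zero fun h => by
      subst h
      exact absurd j.2 (by simp)
    have hk : kronRow p v i j = if j.divNat = i then v j.modNat else 0 := by
      simp only [kronRow, Matrix.of_apply, Nat.mod_lt _ hlam, dif_pos, Fin.ext_iff,
        Fin.coe_divNat]
      rfl
    rw [Matrix.map_apply, Matrix.smul_apply, hk]
    split_ifs
    · simp only [smul_eq_mul]
      push_cast
      ring
    · simp
  rw [h1, h2, norm_mul, mul_pow, Complex.norm_real, Real.norm_eq_abs, sq_abs, div_pow,
    Real.sq_sqrt (Nat.cast_nonneg _)]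
  ring

/-- expected restricted isometry bound
`E sup_{x ∈ T_k} | ‖V̂Φx‖₂² − ‖x‖₂² | ≤ α` for `V̂ = (1/(‖v‖₂√p))(I_p ⊗ v)` and `Φ` from
the sign-randomized bounded orthogonal ensemble, provided `m ≥ p ≥ C₁ k log⁴(n)/α²`.
The expectation is written as the uniform average over all realizations of the row
indices and the signs. -/
theorem stmt12 :
    ∃ C₁ : ℝ, 0 < C₁ ∧
      ∀ (n k p lam : ℕ) (α : ℝ) (v : Fin lam → ℝ) (U : Matrix (Fin n) (Fin n) ℂ),
        2 ≤ n → 0 < k → k ≤ n → 0 < p → 0 < lam →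
        0 < α → α < 1 →
        Uᴴ * U = (n : ℂ) • (1 : Matrix (Fin n) (Fin n) ℂ) →
        (∀ i j, ‖U i j‖ ≤ 1) →
        v ≠ 0 →
        p ≤ p * lam →
        C₁ * (k : ℝ) * (Real.log n) ^ 4 / α ^ 2 ≤ (p : ℝ) →
        (∑ ω : (Fin (p * lam) → Fin n) × (Fin (p * lam) → Bool),
            sSup {c : ℝ | ∃ x ∈ Tk n k,
              c = |(norm2C (((((1 / (norm2 v * Real.sqrt p)) • kronRow p v).map Complex.ofReal) *
                      Matrix.of fun j t => ((rsign (ω.2 j) : ℝ) : ℂ) * U (ω.1 j) t).mulVec x)) ^ 2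
                    - (norm2C x) ^ 2|})
          / (Fintype.card ((Fin (p * lam) → Fin n) × (Fin (p * lam) → Bool)) : ℝ) ≤ α := by
  refine ⟨10 ^ 10, by norm_num, ?_⟩
  intro n k p lam α v U hn hk hkn hp _ hα hα1 hU hU1 hv _ hpk
  have : Nonempty (Fin p) := ⟨⟨0, hp⟩⟩
  have hp' : (0 : ℝ) < p := by exact_mod_cast hp
  have main := expect_iSup_sampleEnergy_sub_le hn hk hkn hU hU1 (β := Fin.divNat)
    (sum_sq_block_normalized p hv)
  have hset : ∀ ω : (Fin (p * lam) → Fin n) × (Fin (p * lam) → Bool),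
      sSup {c : ℝ | ∃ x ∈ Tk n k,
        c = |(norm2C (((((1 / (norm2 v * Real.sqrt p)) • kronRow p v).map Complex.ofReal) *
          Matrix.of fun j t => ((rsign (ω.2 j) : ℝ) : ℂ) * U (ω.1 j) t).mulVec x)) ^ 2
            - (norm2C x) ^ 2|} =
      ⨆ x : Tk n k, |sampleEnergy U Fin.divNat (fun j : Fin (p * lam) => v j.modNat / norm2 v) ω x
        - norm2C (x : Fin n → ℂ) ^ 2| := by
    intro ω
    rw [iSup]
    congr 1
    ext c
    simp only [norm2C_sq_eq_sampleEnergy, Set.mem_ofPred_eq, Set.mem_range, Subtype.exists,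
      exists_prop, eq_comm]
  simp only [hset]
  rw [← Fintype.expect_eq_sum_div_card]
  set D := 𝔼 ω, ⨆ x : Tk n k, |sampleEnergy U Fin.divNat
    (fun j : Fin (p * lam) => v j.modNat / norm2 v) ω x - norm2C (x : Fin n → ℂ) ^ 2|
  have hD0 : 0 ≤ D := Finset.expect_nonneg fun _ _ => Real.iSup_nonneg fun _ => abs_nonneg _
  have hΓ : 5000 * (√k * Real.log n ^ 2 / √(Fintype.card (Fin p))) ≤ α / 20 := by
    rw [Fintype.card_fin, ← mul_div_assoc, div_le_iff₀ (Real.sqrt_pos.2 hp')]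
    refine le_of_sq_le_sq ?_ (by positivity)
    rw [mul_pow, mul_pow, mul_pow, Real.sq_sqrt (by positivity), Real.sq_sqrt (by positivity)]
    rw [div_le_iff₀ (by positivity)] at hpk
    linarith
  have h2 := mul_le_mul_of_nonneg_right hΓ (show 0 ≤ 5 + 4 * D by linarith)
  nlinarith
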